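/- arXiv:1201.0936 — 2 statements merged into one kernel-verified Lean document; each statement's English description precedes it below -/
import Mathlib

section
/- Let n ≥ 4 be an integer, let f = x^{n−1} + x y² + z² ∈ ℂ(x,y,z), and let ℂ(f) be the subfield of ℂ(x,y,z) generated by f over ℂ. Let a be the largest power of 2 dividing 2(n−1), i.e. a = 2^{v₂(2(n−1))} where v₂ denotes the 2-adic valuation. Let K be a field that is a finite field extension of ℂ(f), and assume that L := K ⊗_{ℂ(f)} ℂ(x,y,z) is a field. Then there exist elements g, h ∈ L such that L is generated as a field over (the image of) K by g and h if and only if there exists ρ ∈ K with ρᵃ = f. -/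
open MvPolynomial TensorProduct

set_option synthInstance.maxHeartbeats 1000000
set_option maxHeartbeats 2000000

noncomputable section

/-- The field ℂ(x,y,z): fraction field of the polynomial ring in 3 variables. -/
abbrev Fxyz : Type := FractionRing (MvPolynomial (Fin 3) ℂ)

/-- The images of the variables x, y, z in ℂ(x,y,z). -/
def Vx : Fxyz := algebraMap (MvPolynomial (Fin 3) ℂ) Fxyz (X 0)
def Vy : Fxyz := algebraMap (MvPolynomial (Fin 3) ℂ) Fxyz (X 1)
def Vz : Fxyz := algebraMap (MvPolynomial (Fin 3) ℂ) Fxyz (X 2)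

/-- The element f = x^(n-1) + x y² + z² of ℂ(x,y,z). -/
def fDn (n : ℕ) : Fxyz := Vx ^ (n - 1) + Vx * Vy ^ 2 + Vz ^ 2

/-- The subfield ℂ(f) of ℂ(x,y,z) generated by f over ℂ. -/
def CfDn (n : ℕ) : IntermediateField ℂ Fxyz := IntermediateField.adjoin ℂ {fDn n}

section QuadraticExtension

variable {σ K E : Type*} [Field K] [Field E] [Algebra K E] {c : K} {r : E}

/-- Every polynomial over `E = K + K r` is `a + r b` with `a`, `b` over `K`. -/
theorem exists_eq_map_add_C_mul_map (hgen : ∀ e : E, ∃ a b : K,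
    e = algebraMap K E a + r * algebraMap K E b) (w : MvPolynomial σ E) :
    ∃ a b : MvPolynomial σ K,
      w = MvPolynomial.map (algebraMap K E) a + C r * MvPolynomial.map (algebraMap K E) b := by
  induction w using MvPolynomial.induction_on with
  | C e =>
    obtain ⟨a, b, rfl⟩ := hgen e
    exact ⟨C a, C b, by rw [map_C, map_C, ← C_mul, ← C_add]⟩
  | add p q hp hq =>
    obtain ⟨a, b, rfl⟩ := hp
    obtain ⟨a', b', rfl⟩ := hq
    exact ⟨a + a', b + b', by simp only [map_add]; ring⟩
  | mul_X p i hp =>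
    obtain ⟨a, b, rfl⟩ := hp
    exact ⟨a * X i, b * X i, by simp only [map_mul, map_X]; ring⟩

theorem eq_zero_of_add_mul_eq_zero (hr : r ^ 2 = algebraMap K E c) (hc : ∀ s : K, s ^ 2 ≠ c)
    {a b : K} (h : algebraMap K E a + r * algebraMap K E b = 0) : a = 0 ∧ b = 0 := by
  have hb : b = 0 := by
    by_contra hb
    apply hc (a / b)
    apply (algebraMap K E).injective
    have hb' : algebraMap K E b ≠ 0 := by simpa using hb
    rw [map_pow, map_div₀, ← hr, div_pow, div_eq_iff (pow_ne_zero 2 hb')]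
    linear_combination (algebraMap K E a - r * algebraMap K E b) * h
  subst hb
  simpa using h

theorem map_add_C_mul_map_inj (hr : r ^ 2 = algebraMap K E c) (hc : ∀ s : K, s ^ 2 ≠ c)
    {a b a' b' : MvPolynomial σ K}
    (h : MvPolynomial.map (algebraMap K E) a + C r * MvPolynomial.map (algebraMap K E) b =
      MvPolynomial.map (algebraMap K E) a' + C r * MvPolynomial.map (algebraMap K E) b') :
    a = a' ∧ b = b' := by
  have key (m) : coeff m a - coeff m a' = 0 ∧ coeff m b - coeff m b' = 0 := by
    apply eq_zero_of_add_mul_eq_zero hr hc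
    have := congrArg (coeff m) h
    simp only [coeff_add, coeff_C_mul, coeff_map] at this
    rw [map_sub, map_sub]
    linear_combination this
  exact ⟨MvPolynomial.ext _ _ fun m => sub_eq_zero.1 (key m).1,
    MvPolynomial.ext _ _ fun m => sub_eq_zero.1 (key m).2⟩

/-- A prime of `K[σ]` modulo which the nonsquare `c ∈ K` becomes a square is, up to a constant,
a norm from `K(√c)[σ]`. -/
theorem Prime.eq_const_mul_norm_of_root (hr : r ^ 2 = algebraMap K E c)
    (hgen : ∀ e : E, ∃ a b : K, e = algebraMap K E a + r * algebraMap K E b)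
    (hc : ∀ r : K, r ^ 2 ≠ c) {p : MvPolynomial σ K} (hp : Prime p) {s t : MvPolynomial σ K}
    (hst : p ∣ s ^ 2 - C c * t ^ 2) (ht : ¬ p ∣ t) :
    ∃ (k : K) (a b : MvPolynomial σ K), k ≠ 0 ∧ p = C k * (a ^ 2 - C c * b ^ 2) := by
  obtain ⟨φ, hφ⟩ : ∃ φ : MvPolynomial σ K →+* MvPolynomial σ E,
    φ = MvPolynomial.map (algebraMap K E) := ⟨_, rfl⟩
  have hφi : Function.Injective φ := hφ ▸ map_injective _ (algebraMap K E).injective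
  have hinj {a b a' b' : MvPolynomial σ K} (h : φ a + C r * φ b = φ a' + C r * φ b') :
    a = a' ∧ b = b' := map_add_C_mul_map_inj hr hc (by rwa [hφ] at h)
  have hsurj (w : MvPolynomial σ E) : ∃ a b, w = φ a + C r * φ b :=
    hφ ▸ exists_eq_map_add_C_mul_map hgen w
  have hω : (C r : MvPolynomial σ E) ^ 2 = φ (C c) := by
    rw [← C_pow, hφ, map_C, hr]
  have hnorm (a b : MvPolynomial σ K) : (φ a + C r * φ b) * (φ a - C r * φ b) =
      φ (a ^ 2 - C c * b ^ 2) := by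
    rw [map_sub, map_mul, map_pow, map_pow, ← hω]; ring
  have hunit {a b : MvPolynomial σ K} (h : IsUnit (a ^ 2 - C c * b ^ 2)) :
      IsUnit (φ a + C r * φ b) :=
    isUnit_of_dvd_unit ⟨_, (hnorm a b).symm⟩ (h.map φ)
  have hdvd {s t : MvPolynomial σ K} (h : φ p ∣ φ s + C r * φ t) : p ∣ t := by
    obtain ⟨w, hw⟩ := h
    obtain ⟨a, b, rfl⟩ := hsurj w
    exact ⟨b, (@hinj s t (p * a) (p * b) (by rw [hw, map_mul, map_mul]; ring)).2⟩
  have hnp : ¬ Prime (φ p) := by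
    intro h
    have : φ p ∣ (φ s + C r * φ t) * (φ s - C r * φ t) := by
      rw [hnorm]; exact map_dvd φ hst
    rcases h.dvd_or_dvd this with h | h
    · exact ht (hdvd h)
    · rw [sub_eq_add_neg, ← mul_neg, ← map_neg] at h
      exact ht ((dvd_neg).1 (hdvd h))
  rw [← UniqueFactorizationMonoid.irreducible_iff_prime] at hnp
  have hpu : ¬ IsUnit (φ p) := by
    intro h
    obtain ⟨w, hw⟩ := h.exists_right_inv
    obtain ⟨a, b, rfl⟩ := hsurj w
    refine hp.not_isUnit (IsUnit.of_mul_eq_one a ?_)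
    refine (@hinj (p * a) (p * b) 1 0 ?_).1
    rw [map_mul, map_mul, map_one, map_zero, mul_zero, add_zero, ← hw]
    ring
  rw [irreducible_iff] at hnp
  push Not at hnp
  obtain ⟨q, q', hq, hqu, hqu'⟩ := hnp hpu
  obtain ⟨a, b, rfl⟩ := hsurj q
  obtain ⟨a', b', rfl⟩ := hsurj q'
  have hconj : φ p = (φ a - C r * φ b) * (φ a' - C r * φ b') := by
    have h2 : φ p + C r * φ 0 = φ (a * a' + C c * b * b') + C r * φ (a * b' + a' * b) := by
      rw [hq]; simp only [map_add, map_mul, ← hω, map_zero]; ring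
    have h3 := hinj h2
    have h4 : φ a * φ b' + φ a' * φ b = 0 := by
      rw [← map_mul, ← map_mul, ← map_add, ← h3.2, map_zero]
    rw [h3.1]; simp only [map_add, map_mul, ← hω]; linear_combination C r * h4
  have hsq : (a ^ 2 - C c * b ^ 2) * (a' ^ 2 - C c * b' ^ 2) = p ^ 2 := by
    apply hφi
    rw [map_mul, ← hnorm, ← hnorm, map_pow, pow_two]
    nth_rewrite 1 [hq]
    rw [hconj]
    ring
  obtain ⟨i, hi, hassoc⟩ := (dvd_prime_pow hp 2).1 ⟨_, hsq.symm⟩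
  have hi1 : i = 1 := by
    interval_cases i
    · exact absurd (hunit (by simpa [associated_one_iff_isUnit] using hassoc)) hqu
    · rfl
    · refine absurd (hunit ?_) hqu'
      obtain ⟨v, hv⟩ := hassoc
      rw [← hv] at hsq
      have hne : a ^ 2 - C c * b ^ 2 ≠ 0 := by
        intro h0; rw [h0, zero_mul] at hv; exact pow_ne_zero 2 hp.ne_zero hv.symm
      rw [mul_left_cancel₀ hne hsq]
      exact v.isUnit
  subst hi1
  rw [pow_one] at hassoc
  obtain ⟨v, hv⟩ := hassoc
  obtain ⟨k, hk, hkv⟩ := (MvPolynomial.isUnit_iff_eq_C_of_isReduced).1 v.isUnit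
  exact ⟨k, a, b, hk.ne_zero, by rw [← hv, hkv, mul_comm]⟩

end QuadraticExtension

theorem Prime.eq_const_mul_norm {σ K : Type*} [Field K] {c : K}
    (hc : ∀ r : K, r ^ 2 ≠ c) {p : MvPolynomial σ K} (hp : Prime p) {s t : MvPolynomial σ K}
    (hst : p ∣ s ^ 2 - C c * t ^ 2) (ht : ¬ p ∣ t) :
    ∃ (k : K) (a b : MvPolynomial σ K), k ≠ 0 ∧ p = C k * (a ^ 2 - C c * b ^ 2) := by
  have : Fact (∀ r : K, r ^ 2 ≠ c + 0 * r) := ⟨by simpa using hc⟩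
  refine Prime.eq_const_mul_norm_of_root (E := QuadraticAlgebra K c 0)
    (r := QuadraticAlgebra.omega) ?_ ?_ hc hp hst ht
  · rw [pow_two, QuadraticAlgebra.omega_mul_omega_eq_mk]; rfl
  · intro e
    refine ⟨e.re, e.im, ?_⟩
    ext <;> simp

/-- A nonzero polynomial all of whose primes of odd multiplicity are norms up to constants is
itself a norm up to a constant. -/
theorem exists_eq_const_mul_norm {σ K : Type*} [Field K] {c : K} {u : MvPolynomial σ K}
    (hu : u ≠ 0)
    (h : ∀ p : MvPolynomial σ K, Prime p → Odd (multiplicity p u) →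
      ∃ (k : K) (a b : MvPolynomial σ K), k ≠ 0 ∧ p = C k * (a ^ 2 - C c * b ^ 2)) :
    ∃ (k : K) (a b : MvPolynomial σ K), k ≠ 0 ∧ u = C k * (a ^ 2 - C c * b ^ 2) := by
  classical
  let Q : MvPolynomial σ K → Prop := fun u =>
    ∃ (k : K) (a b : MvPolynomial σ K), k ≠ 0 ∧ u = C k * (a ^ 2 - C c * b ^ 2)
  have hmul : ∀ u v, Q u → Q v → Q (u * v) := by
    rintro _ _ ⟨k, a, b, hk, rfl⟩ ⟨k', a', b', hk', rfl⟩
    refine ⟨k * k', a * a' + C c * b * b', a * b' + a' * b, mul_ne_zero hk hk', ?_⟩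
    rw [C_mul]; ring
  have hone : Q 1 := ⟨1, 1, 0, one_ne_zero, by simp⟩
  let _ := UniqueFactorizationMonoid.strongNormalizationMonoid (α := MvPolynomial σ K)
  obtain ⟨v, hv⟩ := UniqueFactorizationMonoid.prod_normalizedFactors hu
  obtain ⟨k, hk, hkv⟩ := (MvPolynomial.isUnit_iff_eq_C_of_isReduced).1 v.isUnit
  change Q u
  rw [← hv]
  refine hmul _ _ ?_ ⟨k, 1, 0, hk.ne_zero, by simp [hkv]⟩
  rw [Finset.prod_multiset_count]
  refine Finset.prod_induction _ Q hmul hone ?_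
  intro p hp
  rw [Multiset.mem_toFinset] at hp
  have hpp := UniqueFactorizationMonoid.prime_of_normalized_factor p hp
  have hcount : multiplicity p u =
      (UniqueFactorizationMonoid.normalizedFactors u).count p := by
    apply multiplicity_eq_of_emultiplicity_eq_some
    rw [UniqueFactorizationMonoid.emultiplicity_eq_count_normalizedFactors hpp.irreducible hu,
      UniqueFactorizationMonoid.normalize_normalized_factor p hp]
  rcases Nat.even_or_odd ((UniqueFactorizationMonoid.normalizedFactors u).count p) with he | ho
  · obtain ⟨l, hl⟩ := he
    exact ⟨1, p ^ l, 0, one_ne_zero, by rw [hl]; simp; ring⟩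
  · have hQp : Q p := h p hpp (hcount ▸ ho)
    generalize (UniqueFactorizationMonoid.normalizedFactors u).count p = l
    induction l with
    | zero => simpa using hone
    | succ l ih => rw [pow_succ]; exact hmul _ _ ih hQp

theorem Prime.multiplicity_mul {R : Type*} [CommRing R] [IsDomain R]
    [UniqueFactorizationMonoid R] {p a b : R} (hp : Prime p) (ha : a ≠ 0) (hb : b ≠ 0) :
    multiplicity p (a * b) = multiplicity p a + multiplicity p b :=
  _root_.multiplicity_mul hp (FiniteMultiplicity.of_not_isUnit hp.not_isUnit (mul_ne_zero ha hb))

/-- If `p` occurs with odd multiplicity in one of the factors `e j * D - A` and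
`D * Z ^ 2 + A * Y ^ 2` equals the product of these factors up to a square and a power of `D`,
then `c` is a square modulo `p`. -/
theorem Prime.exists_dvd_sq_sub_mul_sq {σ K ι : Type*} [Field K] [Fintype ι] {c i : K}
    (hi : i ^ 2 = -1) {e ε : ι → K} (he : Function.Injective e)
    (hε : ∀ j, ε j ≠ 0) (heε : ∀ j, e j = ε j ^ 2 * c)
    {A D G Y Z d : MvPolynomial σ K} {N : ℕ} (hAD : IsRelPrime A D) (hYZ : IsRelPrime Y Z)
    (hD : D ≠ 0) (hG : G ≠ 0) (hA : ∀ j, C (e j) * D - A ≠ 0)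
    (heq : D ^ N * d ^ 2 * (D * Z ^ 2 + A * Y ^ 2) = D * G ^ 2 * ∏ j, (C (e j) * D - A))
    {p : MvPolynomial σ K} (hp : Prime p) (j : ι)
    (hodd : Odd (multiplicity p (C (e j) * D - A))) :
    ∃ s t : MvPolynomial σ K, p ∣ s ^ 2 - C c * t ^ 2 ∧ ¬ p ∣ t := by
  classical
  have hpj : p ∣ C (e j) * D - A := by
    by_contra h
    rw [multiplicity_eq_zero.2 h] at hodd
    simp at hodd
  have hpD : ¬ p ∣ D := fun h =>
    hp.not_isUnit (hAD ((dvd_sub_right (h.mul_left _)).1 hpj) h)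
  have hother : ∀ j' ≠ j, ¬ p ∣ C (e j') * D - A := by
    intro j' hj' h
    have h1 : p ∣ C (e j' - e j) * D := by
      have := dvd_sub h hpj
      rw [C_sub]
      convert this using 1
      ring
    rcases hp.dvd_or_dvd h1 with h2 | h2
    · refine hp.not_isUnit (isUnit_of_dvd_unit h2 (IsUnit.map C ?_))
      exact (sub_ne_zero.2 fun h => hj' (he h)).isUnit
    · exact hpD h2
  have hprod : ∏ j, (C (e j) * D - A) ≠ 0 := Finset.prod_ne_zero_iff.2 fun j _ => hA j
  have hQ : D ^ N * d ^ 2 * (D * Z ^ 2 + A * Y ^ 2) ≠ 0 :=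
    heq ▸ mul_ne_zero (mul_ne_zero hD (pow_ne_zero 2 hG)) hprod
  have hQ1 : D * Z ^ 2 + A * Y ^ 2 ≠ 0 := right_ne_zero_of_mul hQ
  have hd : d ≠ 0 := fun h => hQ (by simp [h])
  have hrest : ¬ p ∣ ∏ j' ∈ Finset.univ.erase j, (C (e j') * D - A) := fun h => by
    obtain ⟨j', hj', h'⟩ := (hp.dvd_finsetProd_iff _).1 h
    exact hother j' (Finset.ne_of_mem_erase hj') h'
  have hm := congrArg (multiplicity p) heq
  rw [hp.multiplicity_mul (mul_ne_zero (pow_ne_zero _ hD) (pow_ne_zero _ hd)) hQ1,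
    hp.multiplicity_mul (pow_ne_zero _ hD) (pow_ne_zero _ hd),
    hp.multiplicity_mul (mul_ne_zero hD (pow_ne_zero _ hG)) hprod,
    hp.multiplicity_mul hD (pow_ne_zero _ hG),
    ← Finset.mul_prod_erase Finset.univ _ (Finset.mem_univ j),
    hp.multiplicity_mul (hA j) (Finset.prod_ne_zero_iff.2 fun j _ => hA j), pow_two d, pow_two G,
    hp.multiplicity_mul hd hd, hp.multiplicity_mul hG hG,
    multiplicity_eq_zero.2 (fun h => hpD (hp.dvd_of_dvd_pow h)),
    multiplicity_eq_zero.2 hpD, multiplicity_eq_zero.2 hrest] at hm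
  have hpQ : p ∣ D * Z ^ 2 + A * Y ^ 2 := by
    by_contra h
    rw [multiplicity_eq_zero.2 h] at hm
    obtain ⟨l, hl⟩ := hodd
    omega
  have hpN : p ∣ Z ^ 2 + C (e j) * Y ^ 2 := by
    refine (hp.dvd_or_dvd (?_ : p ∣ D * (Z ^ 2 + C (e j) * Y ^ 2))).resolve_left hpD
    have := dvd_add hpQ (hpj.mul_right (Y ^ 2))
    convert this using 1
    ring
  refine ⟨C i * Z, C (ε j) * Y, ?_, ?_⟩
  · have h1 : (C i : MvPolynomial σ K) ^ 2 = -1 := by rw [← C_pow, hi]; simp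
    have h2 : (C (e j) : MvPolynomial σ K) = C (ε j) ^ 2 * C c := by
      rw [heε, C_mul, C_pow]
    rw [← dvd_neg]
    convert hpN using 1
    rw [h2]
    linear_combination (-Z ^ 2) * h1
  · intro h
    have hY : p ∣ Y := by
      refine (hp.dvd_or_dvd h).resolve_left fun h => ?_
      exact hp.not_isUnit (isUnit_of_dvd_unit h (IsUnit.map C (hε j).isUnit))
    refine hp.not_isUnit (hYZ hY (hp.dvd_of_dvd_pow (n := 2) ?_))
    exact (dvd_add_left ((dvd_pow hY two_ne_zero).mul_left _)).1 hpN

/-- Over a rational function field, the function `(x - e₁) * (x - e₂)` attached to two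
degenerate fibres of the conic bundle `z² + x y² = ∏ (e j - x)` is a norm from the quadratic
extension defined by `c`, up to a constant. -/
theorem exists_fibre_mul_fibre_eq_norm {σ K ι L : Type*} [Field K] [Fintype ι] [Field L]
    [Algebra K L] [Algebra (MvPolynomial σ K) L] [IsScalarTower K (MvPolynomial σ K) L]
    [IsFractionRing (MvPolynomial σ K) L] {c i : K} (hc : ∀ r : K, r ^ 2 ≠ c)
    (hi : i ^ 2 = -1) {e ε : ι → K} (he : Function.Injective e)
    (hε : ∀ j, ε j ≠ 0) (heε : ∀ j, e j = ε j ^ 2 * c) {x y z : L}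
    (hx : ∀ j, x ≠ algebraMap K L (e j))
    (heq : z ^ 2 + x * y ^ 2 = ∏ j, (algebraMap K L (e j) - x)) (j₁ j₂ : ι) :
    ∃ (k : K) (a b : L), k ≠ 0 ∧ (x - algebraMap K L (e j₁)) * (x - algebraMap K L (e j₂)) =
      algebraMap K L k * (a ^ 2 - algebraMap K L c * b ^ 2) := by
  classical
  set R := MvPolynomial σ K
  have hinj : Function.Injective (algebraMap R L) := IsFractionRing.injective R L
  have hC (k : K) : algebraMap K L k = algebraMap R L (C k) :=
    IsScalarTower.algebraMap_apply K R L k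
  obtain ⟨A, D, hAD, hxAD⟩ := IsFractionRing.exists_reduced_fraction R x
  have hD : algebraMap R L D ≠ 0 := by
    exact (map_ne_zero_iff _ hinj).2 (nonZeroDivisors.ne_zero D.2)
  have hxD : x * algebraMap R L D = algebraMap R L A := by
    rw [← hxAD]; exact IsLocalization.mk'_spec L A D
  obtain ⟨G, hG⟩ := IsLocalization.exist_integer_multiples_of_finset (nonZeroDivisors R) {y, z}
  have hG0 : algebraMap R L G ≠ 0 := by
    exact (map_ne_zero_iff _ hinj).2 (nonZeroDivisors.ne_zero G.2)
  obtain ⟨Y, hY⟩ := hG y (by simp)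
  obtain ⟨Z, hZ⟩ := hG z (by simp)
  rw [Algebra.smul_def] at hY hZ
  have hxj (j) : (C (e j) * (D : R) - A) ≠ 0 := by
    intro h
    apply hx j
    have := congrArg (algebraMap R L) h
    rw [map_sub, map_mul, map_zero, ← hC, ← hxD] at this
    exact mul_right_cancel₀ hD (by linear_combination -this)
  have hprodL : (algebraMap R L) (∏ j, (C (e j) * (D : R) - A)) =
      (algebraMap R L D) ^ Fintype.card ι * ∏ j, (algebraMap K L (e j) - x) := by
    rw [map_prod, Fintype.card, ← Finset.prod_const, ← Finset.prod_mul_distrib]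
    refine Finset.prod_congr rfl fun j _ => ?_
    rw [map_sub, map_mul, ← hC, ← hxD]; ring
  have heqR : (D : R) ^ Fintype.card ι * (D * Z ^ 2 + A * Y ^ 2) =
      (D * G ^ 2) * ∏ j, (C (e j) * (D : R) - A) := by
    apply hinj
    rw [map_mul _ (_ * _), hprodL, ← heq]
    simp only [map_mul, map_add, map_pow, hY, hZ, ← hxD]
    ring
  have hD' : (D : R) ≠ 0 := nonZeroDivisors.ne_zero D.2
  have hG' : (G : R) ≠ 0 := nonZeroDivisors.ne_zero G.2
  obtain ⟨Y', Z', d, hYZ, hdY, hdZ⟩ :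
      ∃ Y' Z' d : R, IsRelPrime Y' Z' ∧ d * Y' = Y ∧ d * Z' = Z := by
    by_cases hY0 : Y = 0
    · exact ⟨0, 1, Z, isRelPrime_one_right, by simp [hY0], by simp⟩
    · exact UniqueFactorizationMonoid.exists_reduced_factors Y hY0 Z
  have heqR' : (D : R) ^ Fintype.card ι * d ^ 2 * (D * Z' ^ 2 + A * Y' ^ 2) =
      D * G ^ 2 * ∏ j, (C (e j) * (D : R) - A) := by
    rw [← heqR, ← hdY, ← hdZ]; ring
  obtain ⟨k, a, b, hk, hkab⟩ := exists_eq_const_mul_norm (c := c)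
    (u := (C (e j₁) * (D : R) - A) * (C (e j₂) * (D : R) - A)) (mul_ne_zero (hxj _) (hxj _)) (by
      intro p hp hodd
      rw [hp.multiplicity_mul (hxj _) (hxj _), Nat.odd_add] at hodd
      obtain ⟨j, hj⟩ : ∃ j, Odd (multiplicity p (C (e j) * (D : R) - A)) := by
        by_cases h : Odd (multiplicity p (C (e j₁) * (D : R) - A))
        · exact ⟨_, h⟩
        · exact ⟨j₂, Nat.not_even_iff_odd.1 fun h' => h (hodd.2 h')⟩
      obtain ⟨s, t, hst, ht⟩ :=
        hp.exists_dvd_sq_sub_mul_sq hi he hε heε hAD hYZ hD' hG' hxj heqR' j hj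
      exact hp.eq_const_mul_norm hc hst ht)
  refine ⟨k, algebraMap R L a / algebraMap R L D, algebraMap R L b / algebraMap R L D, hk, ?_⟩
  have := congrArg (algebraMap R L) hkab
  simp only [map_mul, map_sub, map_pow, ← hC, ← hxD] at this
  field_simp
  linear_combination this

/-- `p ↦ θ ^ deg p * τ (p (θ))`, for a semilinear `τ` with `τ θ = β / θ`, as a polynomial. -/
def twistedReverse {M : Type*} [Field M] (τ : M →+* M) (β : M) (p : Polynomial M) :
    Polynomial M :=
  ((p.map τ).comp (Polynomial.C β * Polynomial.X)).reverse

theorem natDegree_twistedReverse {M : Type*} [Field M] (τ : M →+* M) {β : M} (hβ : β ≠ 0)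
    {p : Polynomial M} (hp : p.coeff 0 ≠ 0) :
    (twistedReverse τ β p).natDegree = p.natDegree := by
  have h0 : ((p.map τ).comp (Polynomial.C β * Polynomial.X)).coeff 0 ≠ 0 := by
    rw [Polynomial.coeff_zero_eq_eval_zero, Polynomial.eval_comp]
    simpa [← Polynomial.coeff_zero_eq_eval_zero] using hp
  rw [twistedReverse, Polynomial.reverse_natDegree,
    Polynomial.natTrailingDegree_eq_zero.2 (Or.inr h0), Polynomial.natDegree_comp,
    Polynomial.natDegree_C_mul_X _ hβ, Polynomial.natDegree_map]
  simp

theorem aeval_twistedReverse {M Λ : Type*} [Field M] [Field Λ] [Algebra M Λ] (τM : M →+* M)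
    (τ : Λ →+* Λ) (hτ : ∀ m, algebraMap M Λ (τM m) = τ (algebraMap M Λ m)) {β : M} {θ : Λ}
    (hθ0 : θ ≠ 0) (hθ : θ * τ θ = algebraMap M Λ β) (hβ : β ≠ 0) (p : Polynomial M) :
    Polynomial.aeval θ (twistedReverse τM β p) =
      θ ^ p.natDegree * τ (Polynomial.aeval θ p) := by
  let _ : Invertible θ⁻¹ := ⟨θ, by field_simp, by field_simp⟩
  have h := Polynomial.eval₂_reverse_mul_pow (algebraMap M Λ) θ⁻¹
    ((p.map τM).comp (Polynomial.C β * Polynomial.X))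
  have h1 : τ θ = algebraMap M Λ β * θ⁻¹ := by rw [← hθ]; field_simp
  have h2 : (algebraMap M Λ).comp τM = τ.comp (algebraMap M Λ) := RingHom.ext hτ
  rw [Polynomial.natDegree_comp, Polynomial.natDegree_C_mul_X _ hβ, Polynomial.natDegree_map,
    mul_one, Polynomial.eval₂_comp, Polynomial.eval₂_mul, Polynomial.eval₂_C,
    Polynomial.eval₂_X, ← h1, Polynomial.eval₂_map, h2, ← Polynomial.hom_eval₂] at h
  change Polynomial.eval₂ (algebraMap M Λ) θ _ * _ = _ at h
  rw [Polynomial.aeval_def, twistedReverse, Polynomial.aeval_def, ← h, mul_left_comm, ← mul_pow,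
    mul_inv_cancel₀ hθ0, one_pow, mul_one]

theorem eq_norm_mul_pow_of_coprime {M Λ : Type*} [Field M] [Field Λ] [Algebra M Λ]
    (τM : M →+* M) (τ : Λ →+* Λ) (hτ : ∀ m, algebraMap M Λ (τM m) = τ (algebraMap M Λ m))
    (hττ : ∀ w, τ (τ w) = w) {β : M} {θ : Λ} (htr : Transcendental M θ)
    (hθ : θ * τ θ = algebraMap M Λ β) (hβ : β ≠ 0) {W : M} (hW : W ≠ 0) {a b : Polynomial M}
    (hab : IsCoprime a b) (ha : a.coeff 0 ≠ 0) (hb : b.coeff 0 ≠ 0)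
    (h : algebraMap M Λ W * (Polynomial.aeval θ b * τ (Polynomial.aeval θ b)) =
      Polynomial.aeval θ a * τ (Polynomial.aeval θ a)) :
    ∃ (l : M) (d : ℕ), l ≠ 0 ∧ W * (l * τM l) = β ^ d := by
  have hinj : Function.Injective (Polynomial.aeval (R := M) θ) :=
    transcendental_iff_injective.1 htr
  have hθ0 : θ ≠ 0 := fun h0 => htr (h0 ▸ isAlgebraic_zero)
  have hrev := aeval_twistedReverse τM τ hτ hθ0 hθ hβ
  set a' := twistedReverse τM β a
  set b' := twistedReverse τM β b
  have hdega : a'.natDegree = a.natDegree := natDegree_twistedReverse τM hβ ha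
  have hdegb : b'.natDegree = b.natDegree := natDegree_twistedReverse τM hβ hb
  have ha0 : a ≠ 0 := fun h0 => ha (by simp [h0])
  have hb0 : b ≠ 0 := fun h0 => hb (by simp [h0])
  have hne {p : Polynomial M} (hp : p ≠ 0) : Polynomial.aeval θ p ≠ 0 := fun h0 =>
    hp (hinj (by rw [h0, map_zero]))
  have ha'0 : a' ≠ 0 := by
    intro h0
    have := hrev a
    rw [show twistedReverse τM β a = 0 from h0, map_zero, eq_comm, mul_eq_zero] at this
    rcases this with h1 | h1
    · exact pow_ne_zero _ hθ0 h1
    · exact hne ha0 (by simpa using h1)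
  have hb'0 : b' ≠ 0 := by
    intro h0
    have := hrev b
    rw [show twistedReverse τM β b = 0 from h0, map_zero, eq_comm, mul_eq_zero] at this
    rcases this with h1 | h1
    · exact pow_ne_zero _ hθ0 h1
    · exact hne hb0 (by simpa using h1)
  have hpoly : Polynomial.X ^ a.natDegree * (Polynomial.C W * (b * b')) =
      Polynomial.X ^ b.natDegree * (a * a') := by
    apply hinj
    simp only [map_mul, map_pow, Polynomial.aeval_X, Polynomial.aeval_C]
    rw [hrev a, hrev b]
    linear_combination θ ^ a.natDegree * θ ^ b.natDegree * h
  have hdeg : a.natDegree = b.natDegree := by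
    have h1 := congrArg Polynomial.natDegree hpoly
    have hCW : Polynomial.C W ≠ 0 := by simpa using hW
    rw [Polynomial.natDegree_X_pow_mul _ (mul_ne_zero hCW (mul_ne_zero hb0 hb'0)),
      Polynomial.natDegree_X_pow_mul _ (mul_ne_zero ha0 ha'0), Polynomial.natDegree_C_mul hW,
      Polynomial.natDegree_mul hb0 hb'0, Polynomial.natDegree_mul ha0 ha'0, hdega, hdegb] at h1
    omega
  rw [hdeg] at hpoly
  have hpoly' := mul_left_cancel₀ (pow_ne_zero _ Polynomial.X_ne_zero) hpoly
  have hdvd : a ∣ b' := by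
    have h1 : a ∣ b * b' := by
      have h2 : a ∣ Polynomial.C W * (b * b') := ⟨a', hpoly'⟩
      exact (Polynomial.isUnit_C.2 hW.isUnit).dvd_mul_left.1 h2
    exact hab.dvd_of_dvd_mul_left h1
  obtain ⟨q, hq⟩ := hdvd
  have hq0 : q ≠ 0 := fun h0 => hb'0 (by rw [hq, h0, mul_zero])
  have hqdeg : q.natDegree = 0 := by
    have := congrArg Polynomial.natDegree hq
    rw [Polynomial.natDegree_mul ha0 hq0] at this
    omega
  obtain ⟨l, rfl⟩ := Polynomial.natDegree_eq_zero.1 hqdeg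
  have hl0 : l ≠ 0 := by simpa using hq0
  refine ⟨l, b.natDegree, hl0, ?_⟩
  apply (algebraMap M Λ).injective
  have h3 := hrev b
  rw [show twistedReverse τM β b = _ from hq, map_mul, Polynomial.aeval_C] at h3
  have h4 := congrArg τ h3
  rw [map_mul, map_mul, hττ, map_pow] at h4
  simp only [map_mul, map_pow, hτ]
  rw [← hθ, mul_pow]
  have hbn : Polynomial.aeval θ b * τ (Polynomial.aeval θ b) ≠ 0 :=
    mul_ne_zero (hne hb0) (by simpa using hne hb0)
  apply mul_right_cancel₀ hbn
  linear_combination (algebraMap M Λ l * τ (algebraMap M Λ l)) * h +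
    τ (algebraMap M Λ l) * τ (Polynomial.aeval θ a) * h3 +
    θ ^ b.natDegree * τ (Polynomial.aeval θ b) * h4

theorem eq_norm_mul_zpow_of_mem_adjoin {M Λ : Type*} [Field M] [Field Λ] [Algebra M Λ]
    (τM : M →+* M) (τ : Λ →+* Λ) (hτ : ∀ m, algebraMap M Λ (τM m) = τ (algebraMap M Λ m))
    (hττ : ∀ w, τ (τ w) = w) {β : M} {θ : Λ} (htr : Transcendental M θ)
    (hθ : θ * τ θ = algebraMap M Λ β) (hβ : β ≠ 0) {W : M} (hW : W ≠ 0) {v : Λ}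
    (hv : v ∈ IntermediateField.adjoin M {θ}) (h : v * τ v = algebraMap M Λ W) :
    ∃ (l : M) (d : ℤ), l ≠ 0 ∧ W * (l * τM l) = β ^ d := by
  classical
  have hθ0 : θ ≠ 0 := fun h0 => htr (h0 ▸ isAlgebraic_zero)
  obtain ⟨a, b, rfl⟩ := IntermediateField.mem_adjoin_simple_iff M v |>.1 hv
  have hab0 : Polynomial.aeval θ a ≠ 0 ∧ Polynomial.aeval θ b ≠ 0 := by
    constructor <;> intro h0 <;> rw [h0] at h <;> simp at h <;>
      exact hW ((map_eq_zero _).1 h.symm)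
  have ha : a ≠ 0 := fun h0 => hab0.1 (by simp [h0])
  have hb : b ≠ 0 := fun h0 => hab0.2 (by simp [h0])
  obtain ⟨a', b', g, hrel, hga, hgb⟩ := UniqueFactorizationMonoid.exists_reduced_factors a ha b
  have ha' : a' ≠ 0 := fun h0 => ha (by rw [← hga, h0, mul_zero])
  have hb' : b' ≠ 0 := fun h0 => hb (by rw [← hgb, h0, mul_zero])
  obtain ⟨a₀, haX, ha₀⟩ := Polynomial.exists_eq_pow_rootMultiplicity_mul_and_not_dvd a' ha' 0
  obtain ⟨b₀, hbX, hb₀⟩ := Polynomial.exists_eq_pow_rootMultiplicity_mul_and_not_dvd b' hb' 0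
  rw [map_zero, sub_zero, Polynomial.X_dvd_iff] at ha₀ hb₀
  rw [map_zero, sub_zero] at haX hbX
  generalize Polynomial.rootMultiplicity 0 a' = i at haX
  generalize Polynomial.rootMultiplicity 0 b' = j at hbX
  have hcop : IsCoprime a₀ b₀ := by
    rw [← isRelPrime_iff_isCoprime]
    intro q h1 h2
    exact hrel (haX ▸ h1.mul_left _) (hbX ▸ h2.mul_left _)
  have hval : Polynomial.aeval θ a * (θ ^ j * Polynomial.aeval θ b₀) =
      Polynomial.aeval θ b * (θ ^ i * Polynomial.aeval θ a₀) := by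
    rw [← hga, ← hgb, haX, hbX]; simp only [map_mul, map_pow, Polynomial.aeval_X]; ring
  have hvalτ := congrArg τ hval
  simp only [map_mul, map_pow] at hvalτ
  have hbτ : τ (Polynomial.aeval θ b) ≠ 0 := by simpa using hab0.2
  have hN : Polynomial.aeval θ a * τ (Polynomial.aeval θ a) = algebraMap M Λ W *
      (Polynomial.aeval θ b * τ (Polynomial.aeval θ b)) := by
    have h2 := hab0.2
    rw [map_div₀] at h
    field_simp at h
    linear_combination h
  obtain ⟨l, d, hl, hld⟩ := eq_norm_mul_pow_of_coprime τM τ hτ hττ htr hθ hβ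
    (W := W * β ^ (j : ℤ) / β ^ (i : ℤ)) (by simp [hW, hβ]) hcop ha₀ hb₀ (by
      have hβΛ : algebraMap M Λ β ≠ 0 := by simpa using hβ
      simp only [zpow_natCast, map_div₀, map_mul, map_pow]
      field_simp
      rw [← hθ, mul_pow, mul_pow]
      apply mul_left_cancel₀ (mul_ne_zero hab0.2 hbτ)
      linear_combination (Polynomial.aeval θ a * (θ ^ j * Polynomial.aeval θ b₀)) * hvalτ +
        τ (Polynomial.aeval θ b) * (τ θ ^ i * τ (Polynomial.aeval θ a₀)) * hval -
        (θ ^ j * Polynomial.aeval θ b₀) * (τ θ ^ j * τ (Polynomial.aeval θ b₀)) * hN)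
  refine ⟨l, d + i - j, hl, ?_⟩
  rw [zpow_sub₀ hβ, zpow_add₀ hβ, zpow_natCast β d, ← hld]
  field_simp

theorem IntermediateField.exists_eq_add_mul_of_mem_adjoin {F Λ : Type*} [Field F] [Field Λ]
    [Algebra F Λ] {c : F} {r : Λ} (hr : r ^ 2 = algebraMap F Λ c) {w : Λ}
    (hw : w ∈ IntermediateField.adjoin F {r}) :
    ∃ s t : F, w = algebraMap F Λ s + r * algebraMap F Λ t := by
  have hralg : IsAlgebraic F r := by
    refine IsAlgebraic.of_pow two_pos ?_
    rw [hr]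
    exact isAlgebraic_algebraMap c
  have hw' : w ∈ Algebra.adjoin F {r} := by
    rwa [← IntermediateField.adjoin_simple_toSubalgebra_of_isAlgebraic hralg]
  induction hw' using Algebra.adjoin_induction with
  | mem x hx => exact ⟨0, 1, by rw [Set.mem_singleton_iff.1 hx]; simp⟩
  | algebraMap s => exact ⟨s, 0, by simp⟩
  | add x y hx hy ihx ihy =>
    obtain ⟨s, t, rfl⟩ := ihx (by
      rwa [← IntermediateField.adjoin_simple_toSubalgebra_of_isAlgebraic hralg] at hx)
    obtain ⟨s', t', rfl⟩ := ihy (by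
      rwa [← IntermediateField.adjoin_simple_toSubalgebra_of_isAlgebraic hralg] at hy)
    exact ⟨s + s', t + t', by simp; ring⟩
  | mul x y hx hy ihx ihy =>
    obtain ⟨s, t, rfl⟩ := ihx (by
      rwa [← IntermediateField.adjoin_simple_toSubalgebra_of_isAlgebraic hralg] at hx)
    obtain ⟨s', t', rfl⟩ := ihy (by
      rwa [← IntermediateField.adjoin_simple_toSubalgebra_of_isAlgebraic hralg] at hy)
    refine ⟨s * s' + c * t * t', s * t' + t * s', ?_⟩
    simp only [map_add, map_mul]
    linear_combination (algebraMap F Λ t * algebraMap F Λ t') * hr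

theorem exists_eq_norm_or_mul_eq_norm_of_root {F L Λ : Type*} [Field F] [Field L] [Field Λ]
    [Algebra F L] [Algebra L Λ] [Algebra F Λ] [IsScalarTower F L Λ] (h2 : (2 : F) ≠ 0)
    {c β W : F} (hc : c ≠ 0) {r : Λ} (hr : r ^ 2 = algebraMap F Λ c)
    (hΛ : ∀ w : Λ, ∃ a b : L, w = algebraMap L Λ a + r * algebraMap L Λ b)
    (τ : Λ →+* Λ) (hτL : ∀ a : L, τ (algebraMap L Λ a) = algebraMap L Λ a) (hτr : τ r = -r)
    {S T : L} (hST : S ^ 2 - algebraMap F L c * T ^ 2 = algebraMap F L β) (hβ : β ≠ 0)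
    (hgen : IntermediateField.adjoin F {S, T} = ⊤) (hS : Transcendental F S) (hW : W ≠ 0)
    {a b : L} (hab : a ^ 2 - algebraMap F L c * b ^ 2 = algebraMap F L W) :
    ∃ s t : F, s ^ 2 - c * t ^ 2 = W ∨ s ^ 2 - c * t ^ 2 = W * β := by
  set M : IntermediateField F Λ := IntermediateField.adjoin F {r}
  have hrM : r ∈ M := IntermediateField.mem_adjoin_simple_self F r
  have hτF (s : F) : τ (algebraMap F Λ s) = algebraMap F Λ s := by
    rw [IsScalarTower.algebraMap_apply F L Λ, hτL]
  have hττ (w : Λ) : τ (τ w) = w := by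
    obtain ⟨a, b, rfl⟩ := hΛ w
    simp [hτL, hτr]
  have hralg : IsAlgebraic F r := by
    refine IsAlgebraic.of_pow two_pos ?_
    rw [hr]; exact isAlgebraic_algebraMap c
  have hM (m : Λ) (hm : m ∈ M) : ∃ s t : F, m = algebraMap F Λ s + r * algebraMap F Λ t :=
    IntermediateField.exists_eq_add_mul_of_mem_adjoin hr hm
  have hτM (m : M) : τ m ∈ M := by
    obtain ⟨s, t, hst⟩ := hM m m.2
    rw [hst, map_add, map_mul, hτF, hτF, hτr]
    exact add_mem (M.algebraMap_mem s) (mul_mem (neg_mem hrM) (M.algebraMap_mem t))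
  let τM : M →+* M := (τ.comp (algebraMap M Λ)).codRestrict M hτM
  set θ : Λ := algebraMap L Λ S + r * algebraMap L Λ T with hθdef
  have hτθ : τ θ = algebraMap L Λ S - r * algebraMap L Λ T := by
    rw [hθdef, map_add, map_mul, hτL, hτL, hτr]; ring
  have hnorm (a b : L) : (algebraMap L Λ a + r * algebraMap L Λ b) *
      (algebraMap L Λ a - r * algebraMap L Λ b) =
        algebraMap L Λ (a ^ 2 - algebraMap F L c * b ^ 2) := by
    rw [map_sub, map_mul, map_pow, map_pow, ← IsScalarTower.algebraMap_apply, ← hr]; ring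
  have hθ : θ * τ θ = algebraMap F Λ β := by
    rw [hτθ, hnorm, hST, ← IsScalarTower.algebraMap_apply]
  have hβΛ : algebraMap F Λ β ≠ 0 := by simpa using hβ
  have hθ0 : θ ≠ 0 := fun h => hβΛ (by rw [← hθ, h, zero_mul])
  have h2Λ : (2 : Λ) ≠ 0 := by
    have := (map_ne_zero (algebraMap F Λ)).2 h2
    rwa [map_ofNat] at this
  have htr : Transcendental M θ := by
    intro halg
    have : Algebra.IsAlgebraic F M :=
      IntermediateField.isAlgebraic_adjoin_simple hralg.isIntegral
    have h1 : IsAlgebraic F θ := halg.restrictScalars F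
    have h3 : IsAlgebraic F (τ θ) := by
      have : τ θ = algebraMap F Λ β * θ⁻¹ := by rw [← hθ]; field_simp
      rw [this]
      exact (isAlgebraic_algebraMap β).mul h1.inv
    apply hS
    rw [← isAlgebraic_algebraMap_iff (algebraMap L Λ).injective]
    have h4 : algebraMap L Λ S = algebraMap F Λ 2⁻¹ * (θ + τ θ) := by
      rw [hτθ, hθdef, map_inv₀, map_ofNat]; field_simp; ring
    rw [h4]
    exact (isAlgebraic_algebraMap _).mul (h1.add h3)
  have htop (v : Λ) : v ∈ IntermediateField.adjoin M {θ} := by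
    set J := IntermediateField.adjoin M {θ}
    have hFJ (s : F) : algebraMap F Λ s ∈ J := J.algebraMap_mem (algebraMap F M s)
    have hrJ : r ∈ J := J.algebraMap_mem ⟨r, hrM⟩
    have hθJ : θ ∈ J := IntermediateField.mem_adjoin_simple_self M θ
    have hτθJ : τ θ ∈ J := by
      have : τ θ = algebraMap F Λ β * θ⁻¹ := by rw [← hθ]; field_simp
      rw [this]
      exact mul_mem (hFJ β) (inv_mem hθJ)
    have hSJ : algebraMap L Λ S ∈ J := by
      have h4 : algebraMap L Λ S = algebraMap F Λ 2⁻¹ * (θ + τ θ) := by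
        rw [hτθ, hθdef, map_inv₀, map_ofNat]; field_simp; ring
      rw [h4]
      exact mul_mem (hFJ _) (add_mem hθJ hτθJ)
    have hr0 : r ≠ 0 := fun h => hc (by simpa [h] using hr.symm)
    have hTJ : algebraMap L Λ T ∈ J := by
      have h5 : algebraMap L Λ T = r⁻¹ * (θ - algebraMap L Λ S) := by rw [hθdef]; field_simp; ring
      rw [h5]
      exact mul_mem (inv_mem hrJ) (sub_mem hθJ hSJ)
    have hLJ (a : L) : algebraMap L Λ a ∈ J := by
      have hle : IntermediateField.adjoin F {S, T} ≤
          (J.restrictScalars F).comap (IsScalarTower.toAlgHom F L Λ) := by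
        rw [IntermediateField.adjoin_le_iff]
        rintro _ (rfl | rfl)
        · exact hSJ
        · exact hTJ
      rw [hgen] at hle
      exact hle (IntermediateField.mem_top (x := a))
    obtain ⟨a, b, rfl⟩ := hΛ v
    exact add_mem (hLJ a) (mul_mem hrJ (hLJ b))
  obtain ⟨l, d, hl, hld⟩ := eq_norm_mul_zpow_of_mem_adjoin τM τ (fun m => rfl) hττ htr
    (β := algebraMap F M β) hθ (by simpa using hβ) (W := algebraMap F M W) (by simpa using hW)
    (htop (algebraMap L Λ a + r * algebraMap L Λ b)) (by
      rw [map_add, map_mul, hτL, hτL, hτr, neg_mul, ← sub_eq_add_neg, hnorm, hab,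
        ← IsScalarTower.algebraMap_apply]
      rfl)
  obtain ⟨s, t, hst⟩ := hM l l.2
  have hnl : W * (s ^ 2 - c * t ^ 2) = β ^ d := by
    apply (algebraMap F Λ).injective
    have h6 := congrArg (algebraMap M Λ) hld
    rw [map_mul, map_mul, map_zpow₀, ← IsScalarTower.algebraMap_apply,
      ← IsScalarTower.algebraMap_apply] at h6
    change _ * ((l : Λ) * τ l) = _ at h6
    rw [hst, map_add, map_mul, hτF, hτF, hτr] at h6
    rw [map_zpow₀, ← h6]
    simp only [map_mul, map_sub, map_pow, ← hr]
    ring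
  have hn0 : s ^ 2 - c * t ^ 2 ≠ 0 := right_ne_zero_of_mul (hnl ▸ zpow_ne_zero d hβ)
  set n := s ^ 2 - c * t ^ 2 with hn
  rcases Int.even_or_odd' d with ⟨k, hk | hk⟩
  · refine ⟨β ^ k * s / n, β ^ k * t / n, Or.inl ?_⟩
    rw [hk, two_mul, zpow_add₀ hβ] at hnl
    field_simp
    linear_combination β ^ k * β ^ k * hn.symm - n * hnl
  · refine ⟨β * β ^ k * s / n, β * β ^ k * t / n, Or.inr ?_⟩
    rw [hk, two_mul, zpow_add₀ hβ, zpow_add₀ hβ, zpow_one] at hnl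
    field_simp
    linear_combination β * β ^ k * β ^ k * hn.symm - n * hnl


/-- If `W` becomes a norm from `L(√c)` over the function field `L` of the conic
`S² - c T² = β` over `F`, then `W` or `W β` is a norm from `F(√c)`. -/
theorem exists_eq_norm_or_mul_eq_norm {F L : Type*} [Field F] [Field L]
    [Algebra F L] (h2 : (2 : F) ≠ 0)
    {c β W : F} (hc : ∀ s : L, s ^ 2 ≠ algebraMap F L c)
    {S T : L} (hST : S ^ 2 - algebraMap F L c * T ^ 2 = algebraMap F L β) (hβ : β ≠ 0)
    (hgen : IntermediateField.adjoin F {S, T} = ⊤) (hS : Transcendental F S) (hW : W ≠ 0)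
    {a b : L} (hab : a ^ 2 - algebraMap F L c * b ^ 2 = algebraMap F L W) :
    ∃ s t : F, s ^ 2 - c * t ^ 2 = W ∨ s ^ 2 - c * t ^ 2 = W * β := by
  have : Fact (∀ r : L, r ^ 2 ≠ algebraMap F L c + 0 * r) := ⟨by simpa using hc⟩
  refine exists_eq_norm_or_mul_eq_norm_of_root (Λ := QuadraticAlgebra L (algebraMap F L c) 0) h2
    (fun h => hc 0 (by simp [h])) (r := QuadraticAlgebra.omega) ?_ ?_ (starRingEnd _) ?_ ?_
    hST hβ hgen hS hW hab
  · rw [pow_two, QuadraticAlgebra.omega_mul_omega_eq_mk]; rfl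
  · intro e
    refine ⟨e.re, e.im, ?_⟩
    ext <;> simp
  · intro a
    rw [starRingEnd_apply]
    ext <;> simp
  · rw [starRingEnd_apply]
    ext <;> simp

theorem exists_eq_norm_or_mul_eq_norm_of_conic {F L : Type*} [Field F] [Field L]
    [Algebra F L] (h2 : (2 : F) ≠ 0) {c β W X A B i : F} (hi : i ^ 2 = -1)
    (hc : ∀ s : L, s ^ 2 ≠ algebraMap F L c) (hX : X ≠ 0) (hB : B ≠ 0) (hβ : β ≠ 0)
    (hβAB : β = A ^ 2 - X * c * B ^ 2) {y z : L}
    (hyz : z ^ 2 + algebraMap F L X * y ^ 2 = algebraMap F L β)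
    (hgen : IntermediateField.adjoin F {y, z} = ⊤) (hy : Transcendental F y) (hW : W ≠ 0)
    {a b : L} (hab : a ^ 2 - algebraMap F L c * b ^ 2 = algebraMap F L W) :
    ∃ s t : F, s ^ 2 - c * t ^ 2 = W ∨ s ^ 2 - c * t ^ 2 = W * β := by
  have hc0 : c ≠ 0 := by
    rintro rfl
    exact hc 0 (by simp)
  have hi0 : i ≠ 0 := by
    rintro rfl
    norm_num at hi
  have hXL : algebraMap F L X ≠ 0 := by simpa using hX
  have hBL : algebraMap F L B ≠ 0 := by simpa using hB
  have hcL : algebraMap F L c ≠ 0 := by simpa using hc0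
  have hiL : algebraMap F L i ≠ 0 := by simpa using hi0
  have hiL2 : algebraMap F L i ^ 2 = -1 := by rw [← map_pow, hi]; simp
  have hz : Transcendental F z := by
    intro hz
    refine hy (IsAlgebraic.of_pow two_pos ?_)
    have : y ^ 2 = algebraMap F L X⁻¹ * (algebraMap F L β - z ^ 2) := by
      rw [map_inv₀]; field_simp; linear_combination hyz
    rw [this]
    exact (isAlgebraic_algebraMap _).mul ((isAlgebraic_algebraMap _).sub (hz.pow 2))
  have hzA : z - algebraMap F L A ≠ 0 := by
    intro h
    rw [sub_eq_zero.1 h] at hz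
    exact hz (isAlgebraic_algebraMap _)
  have hβL : algebraMap F L β = algebraMap F L A ^ 2 -
      algebraMap F L X * algebraMap F L c * algebraMap F L B ^ 2 := by rw [hβAB]; simp
  set S : L := (algebraMap F L A * z - algebraMap F L β) / (z - algebraMap F L A) with hSdef
  set T : L := -(algebraMap F L i * algebraMap F L X * algebraMap F L B * y) /
    (z - algebraMap F L A) with hTdef
  have hSA : S - algebraMap F L A = algebraMap F L X * algebraMap F L c * algebraMap F L B ^ 2 /
      (z - algebraMap F L A) := by
    rw [hSdef, eq_div_iff hzA, sub_mul, div_mul_cancel₀ _ hzA]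
    linear_combination -hβL
  have hSA0 : S - algebraMap F L A ≠ 0 := by
    rw [hSA]
    exact div_ne_zero (mul_ne_zero (mul_ne_zero hXL hcL) (pow_ne_zero 2 hBL)) hzA
  have hzS : z = algebraMap F L A + algebraMap F L X * algebraMap F L c * algebraMap F L B ^ 2 /
      (S - algebraMap F L A) := by
    rw [hSA]; field_simp; ring
  have hyT : y = algebraMap F L i * (T * (z - algebraMap F L A)) /
      (algebraMap F L X * algebraMap F L B) := by
    rw [hTdef]; field_simp; linear_combination y * hiL2
  have hST : S ^ 2 - algebraMap F L c * T ^ 2 = algebraMap F L β := by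
    rw [hSdef, hTdef, div_pow, div_pow, mul_div_assoc', ← sub_div, div_eq_iff (pow_ne_zero 2 hzA)]
    linear_combination -(algebraMap F L c * algebraMap F L X ^ 2 * algebraMap F L B ^ 2 * y ^ 2)
      * hiL2 + algebraMap F L c * algebraMap F L X * algebraMap F L B ^ 2 * hyz
      + (algebraMap F L β - z ^ 2) * hβL
  have key (M : IntermediateField F L) (h : S ∈ M) : z ∈ M := by
    rw [hzS]
    exact add_mem (M.algebraMap_mem _) (div_mem (mul_mem (mul_mem (M.algebraMap_mem _)
      (M.algebraMap_mem _)) (pow_mem (M.algebraMap_mem _) 2)) (sub_mem h (M.algebraMap_mem _)))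
  refine exists_eq_norm_or_mul_eq_norm h2 hc hST hβ ?_ ?_ hW hab
  · rw [eq_top_iff, ← hgen, IntermediateField.adjoin_le_iff]
    have hSm : S ∈ IntermediateField.adjoin F {S, T} :=
      IntermediateField.subset_adjoin F _ (by simp)
    have hTm : T ∈ IntermediateField.adjoin F {S, T} :=
      IntermediateField.subset_adjoin F _ (by simp)
    have hzm := key _ hSm
    rintro w (rfl | rfl)
    · rw [hyT]
      exact div_mem (mul_mem (algebraMap_mem _ _) (mul_mem hTm (sub_mem hzm (algebraMap_mem _ _))))
        (mul_mem (algebraMap_mem _ _) (algebraMap_mem _ _))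
    · exact hzm
  · intro hS
    exact hz (mem_algebraicClosure_iff.1
      (key (algebraicClosure F L) (mem_algebraicClosure_iff.2 hS)))

theorem Polynomial.even_rootMultiplicity_sq_sub_mul_sq {K : Type*} [Field K] {c : K}
    (hc : ∀ r : K, r ^ 2 ≠ c) {s t : Polynomial K}
    (h : s ^ 2 - Polynomial.C c * t ^ 2 ≠ 0) (e : K) :
    Even ((s ^ 2 - Polynomial.C c * t ^ 2).rootMultiplicity e) := by
  classical
  obtain ⟨s', t', hs, ht, hu⟩ := extract_gcd s t
  obtain ⟨u, v, huv⟩ := (gcd_isUnit_iff _ _).1 hu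
  set g := gcd s t
  have hfac : s ^ 2 - Polynomial.C c * t ^ 2 = g ^ 2 * (s' ^ 2 - Polynomial.C c * t' ^ 2) := by
    rw [hs, ht]; ring
  rw [hfac] at h ⊢
  rw [Polynomial.rootMultiplicity_mul h]
  have hg : g ≠ 0 := by rintro h0; simp [h0] at h
  have h0 : (s' ^ 2 - Polynomial.C c * t' ^ 2).rootMultiplicity e = 0 := by
    refine Polynomial.rootMultiplicity_eq_zero fun hr => ?_
    simp only [Polynomial.IsRoot, Polynomial.eval_sub, Polynomial.eval_pow, Polynomial.eval_mul,
      Polynomial.eval_C] at hr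
    have huv' := congrArg (Polynomial.eval e) huv
    simp only [Polynomial.eval_add, Polynomial.eval_mul, Polynomial.eval_one] at huv'
    by_cases ht0 : t'.eval e = 0
    · have hs0 : s'.eval e = 0 := by simpa [ht0] using hr
      simp [hs0, ht0] at huv'
    · refine hc (s'.eval e / t'.eval e) ?_
      field_simp
      linear_combination hr
  rw [h0, sq, Polynomial.rootMultiplicity_mul (mul_ne_zero hg hg), add_zero]
  exact ⟨_, rfl⟩

theorem sq_sub_mul_sq_ne_aeval {K L : Type*} [Field K] [Field L] [Algebra K L] {c : K}
    (hc : ∀ r : K, r ^ 2 ≠ c) {x : L} (hx : Transcendental K x) {s t : L}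
    (hs : s ∈ IntermediateField.adjoin K {x}) (ht : t ∈ IntermediateField.adjoin K {x})
    {e : K} {w : Polynomial K} (hw : w.eval e ≠ 0) :
    s ^ 2 - algebraMap K L c * t ^ 2 ≠
      Polynomial.aeval x ((Polynomial.X - Polynomial.C e) * w) := by
  intro h
  obtain ⟨p, q, rfl⟩ := (IntermediateField.mem_adjoin_simple_iff K s).1 hs
  obtain ⟨p', q', rfl⟩ := (IntermediateField.mem_adjoin_simple_iff K t).1 ht
  have hinj := transcendental_iff_injective.1 hx
  have hw0 : w ≠ 0 := by rintro rfl; simp at hw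
  have hXw : (Polynomial.X - Polynomial.C e) * w ≠ 0 :=
    mul_ne_zero (Polynomial.X_sub_C_ne_zero e) hw0
  -- normalise vanishing denominators
  have norm (p q : Polynomial K) : ∃ p' q' : Polynomial K, q' ≠ 0 ∧
      Polynomial.aeval x p / Polynomial.aeval x q =
        Polynomial.aeval x p' / Polynomial.aeval x q' := by
    by_cases hq : q = 0
    · exact ⟨0, 1, one_ne_zero, by simp [hq]⟩
    · exact ⟨p, q, hq, rfl⟩
  obtain ⟨p, q, hq, hpq⟩ := norm p q
  obtain ⟨p', q', hq', hpq'⟩ := norm p' q'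
  rw [hpq, hpq'] at h
  have hqx : Polynomial.aeval x q ≠ 0 := by simpa using (map_ne_zero_iff _ hinj).2 hq
  have hqx' : Polynomial.aeval x q' ≠ 0 := by simpa using (map_ne_zero_iff _ hinj).2 hq'
  have hpoly : (p * q') ^ 2 - Polynomial.C c * (p' * q) ^ 2 =
      (Polynomial.X - Polynomial.C e) * w * (q * q') ^ 2 := by
    apply hinj
    simp only [map_sub, map_mul, map_pow, Polynomial.aeval_C] at h ⊢
    rw [← h]
    field_simp
  have hne : (Polynomial.X - Polynomial.C e) * w * (q * q') ^ 2 ≠ 0 :=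
    mul_ne_zero hXw (pow_ne_zero 2 (mul_ne_zero hq hq'))
  have heven := Polynomial.even_rootMultiplicity_sq_sub_mul_sq hc (hpoly ▸ hne) e
  rw [hpoly, Polynomial.rootMultiplicity_mul hne, Polynomial.rootMultiplicity_mul hXw,
    Polynomial.rootMultiplicity_X_sub_C_self, Polynomial.rootMultiplicity_eq_zero hw, sq,
    Polynomial.rootMultiplicity_mul
      (mul_ne_zero (mul_ne_zero hq hq') (mul_ne_zero hq hq'))] at heven
  revert heven
  rw [imp_false, Nat.not_even_iff_odd]
  exact ⟨_, by ring⟩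

theorem exists_prod_eq_sq_sub_mul_sq {K ι : Type*} [Field K] (F : Subfield K) {x c : K}
    (hx : x ∈ F) (hc : c ∈ F) (ε : ι → K) (hε : ∀ j, ε j ∈ F) (s : Finset ι) :
    (Even s.card → ∃ A ∈ F, ∃ B ∈ F, ∏ j ∈ s, (ε j ^ 2 * c - x) = A ^ 2 - x * c * B ^ 2) ∧
    (Odd s.card → ∃ A ∈ F, ∃ B ∈ F, ∏ j ∈ s, (ε j ^ 2 * c - x) = c * A ^ 2 - x * B ^ 2) := by
  classical
  induction s using Finset.induction_on with
  | empty => exact ⟨fun _ => ⟨1, one_mem F, 0, zero_mem F, by simp⟩, by simp⟩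
  | insert j s hj ih =>
    rw [Finset.card_insert_of_notMem hj, Finset.prod_insert hj, Nat.even_add_one,
      Nat.odd_add_one, Nat.not_even_iff_odd, Nat.not_odd_iff_even]
    refine ⟨fun h => ?_, fun h => ?_⟩
    · obtain ⟨A, hA, B, hB, h⟩ := ih.2 h
      exact ⟨c * ε j * A + x * B, add_mem (mul_mem (mul_mem hc (hε j)) hA) (mul_mem hx hB),
        ε j * B + A, add_mem (mul_mem (hε j) hB) hA, by rw [h]; ring⟩
    · obtain ⟨A, hA, B, hB, h⟩ := ih.1 h
      exact ⟨A * ε j + x * B, add_mem (mul_mem hA (hε j)) (mul_mem hx hB),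
        A + c * B * ε j, add_mem hA (mul_mem (mul_mem hc hB) (hε j)), by rw [h]; ring⟩

theorem sq_ne_algebraMap_of_isFractionRing_mvPolynomial {σ K L : Type*} [Field K] [Field L]
    [Algebra (MvPolynomial σ K) L] [Algebra K L] [IsScalarTower K (MvPolynomial σ K) L]
    [IsFractionRing (MvPolynomial σ K) L] {c : K} (hc : ∀ r : K, r ^ 2 ≠ c) (s : L) :
    s ^ 2 ≠ algebraMap K L c := by
  intro hs
  have hc0 : c ≠ 0 := by
    rintro rfl
    exact hc 0 (by simp)
  have hint : IsIntegral (MvPolynomial σ K) s := by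
    refine IsIntegral.of_pow two_pos ?_
    rw [hs, IsScalarTower.algebraMap_apply K (MvPolynomial σ K) L]
    exact isIntegral_algebraMap
  obtain ⟨r, rfl⟩ := IsIntegrallyClosed.isIntegral_iff.1 hint
  have hr : r ^ 2 = C c := by
    apply IsFractionRing.injective (MvPolynomial σ K) L
    rw [map_pow, hs, IsScalarTower.algebraMap_apply K (MvPolynomial σ K) L]
    rfl
  have hunit : IsUnit r := by
    refine (isUnit_pow_iff two_ne_zero).1 ?_
    rw [hr]
    exact hc0.isUnit.map C
  obtain ⟨d, -, rfl⟩ := MvPolynomial.isUnit_iff_eq_C_of_isReduced.1 hunit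
  refine hc d (C_injective σ K ?_)
  rw [map_pow, hr]

theorem IntermediateField.adjoin_adjoin_simple_eq_top {K L : Type*} [Field K] [Field L]
    [Algebra K L] {x y z : L} (h : IntermediateField.adjoin K {x, y, z} = ⊤) :
    IntermediateField.adjoin (IntermediateField.adjoin K {x}) {y, z} = ⊤ := by
  apply IntermediateField.restrictScalars_injective K
  rw [IntermediateField.adjoin_adjoin_left, IntermediateField.restrictScalars_top, ← h]
  rfl

/-- The surface `z² + x y² = ∏ (eⱼ - x)` is not rational when the `eⱼ` are all in the nontrivial
square class of `c`. -/
theorem not_generates_of_not_isSquare {σ K ι L : Type*} [Field K] [Fintype ι]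
    [Field L] [Algebra (MvPolynomial σ K) L] [Algebra K L] [IsScalarTower K (MvPolynomial σ K) L]
    [IsFractionRing (MvPolynomial σ K) L] (h2 : (2 : K) ≠ 0)
    {c i : K} (hc : ∀ r : K, r ^ 2 ≠ c) (hi : i ^ 2 = -1) {e ε : ι → K}
    (he : Function.Injective e) (hε : ∀ j, ε j ≠ 0) (heε : ∀ j, e j = ε j ^ 2 * c)
    (hcard : 3 ≤ Fintype.card ι)
    {x y z : L} (hx : Transcendental K x)
    (hy : Transcendental (IntermediateField.adjoin K {x}) y)
    (heq : z ^ 2 + x * y ^ 2 = ∏ j, (algebraMap K L (e j) - x)) :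
    IntermediateField.adjoin K {x, y, z} ≠ ⊤ := by
  classical
  intro hgen
  set F := IntermediateField.adjoin K {x}
  obtain ⟨j₁, j₂, j₃, h12, h13, h23⟩ := Fintype.two_lt_card_iff.1 hcard
  have hxe (j : ι) : x ≠ algebraMap K L (e j) := by
    rintro h
    exact hx (h ▸ isAlgebraic_algebraMap _)
  have hx0 : x ≠ 0 := by
    rintro rfl
    exact hx (isAlgebraic_zero)
  have hc0 : c ≠ 0 := by
    rintro rfl
    exact hc 0 (by simp)
  have hxF : x ∈ F := IntermediateField.mem_adjoin_simple_self K x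
  obtain ⟨k, a, b, hk, hab⟩ :=
    exists_fibre_mul_fibre_eq_norm (σ := σ) (x := x) hc hi he hε heε hxe heq j₁ j₂
  have hk' : algebraMap K L k ≠ 0 := by simpa using hk
  have hcL := sq_ne_algebraMap_of_isFractionRing_mvPolynomial (σ := σ) (L := L) hc
  -- the polynomials behind the right hand sides
  let w : Polynomial K := Polynomial.C k⁻¹ * (Polynomial.X - Polynomial.C (e j₂))
  let P : Polynomial K := ∏ j, (Polynomial.C (e j) - Polynomial.X)
  let P₃ : Polynomial K := ∏ j ∈ Finset.univ.erase j₃, (Polynomial.C (e j) - Polynomial.X)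
  have hP : P = (Polynomial.X - Polynomial.C (e j₃)) * -P₃ := by
    rw [mul_neg, ← neg_mul, neg_sub]
    exact (Finset.mul_prod_erase _ _ (Finset.mem_univ j₃)).symm
  have hP₃ : P₃.eval (e j₃) ≠ 0 := by
    rw [Polynomial.eval_prod, Finset.prod_ne_zero_iff]
    intro j hj
    simp only [Polynomial.eval_sub, Polynomial.eval_C, Polynomial.eval_X]
    exact sub_ne_zero.2 (he.ne (Finset.ne_of_mem_erase hj))
  have hPx : Polynomial.aeval x P = ∏ j, (algebraMap K L (e j) - x) := by
    simp [P, map_prod]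
  have hw₁ : w.eval (e j₁) ≠ 0 := by
    simpa [w, hk, sub_eq_zero] using he.ne h12
  have hw₃ : ((Polynomial.X - Polynomial.C (e j₁)) * w).eval (e j₃) ≠ 0 := by
    simpa [w, hk, sub_eq_zero] using ⟨(he.ne h13).symm, (he.ne h23).symm⟩
  have he₃ : e j₃ ≠ 0 := by
    rw [heε]
    exact mul_ne_zero (pow_ne_zero 2 (hε _)) hc0
  -- it suffices to treat a conic with split coefficient
  have main (Q : Polynomial K) (hQ : Q.eval (e j₃) ≠ 0) (A B : L) (hA : A ∈ F) (hB : B ∈ F)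
      (hAB : Polynomial.aeval x ((Polynomial.X - Polynomial.C (e j₃)) * Q) =
        A ^ 2 - x * algebraMap K L c * B ^ 2)
      (y z : L) (hy : Transcendental F y)
      (hyz : z ^ 2 + x * y ^ 2 = Polynomial.aeval x ((Polynomial.X - Polynomial.C (e j₃)) * Q))
      (hgen : IntermediateField.adjoin F {y, z} = ⊤) : False := by
    have hB0 : B ≠ 0 := by
      rintro rfl
      refine sq_sub_mul_sq_ne_aeval hc hx hA (zero_mem F) hQ ?_
      rw [hAB]; ring
    let xF : F := ⟨x, hxF⟩
    have haeval (p : Polynomial K) :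
        algebraMap F L (Polynomial.aeval xF p) = Polynomial.aeval x p :=
      (Polynomial.aeval_algebraMap_apply L xF p).symm
    have haeval0 (p : Polynomial K) (hp : p ≠ 0) : Polynomial.aeval xF p ≠ 0 := by
      intro h0
      have := haeval p
      rw [h0, map_zero] at this
      exact hp (transcendental_iff_injective.1 hx (by simpa using this.symm))
    have hQ0 : Q ≠ 0 := by rintro rfl; simp at hQ
    have hw0 : w ≠ 0 := by intro h; rw [h] at hw₁; simp at hw₁
    obtain ⟨s, t, hst⟩ := exists_eq_norm_or_mul_eq_norm_of_conic (F := F) (L := L)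
      (c := algebraMap K F c) (X := xF) (A := ⟨A, hA⟩) (B := ⟨B, hB⟩) (i := algebraMap K F i)
      (β := Polynomial.aeval xF ((Polynomial.X - Polynomial.C (e j₃)) * Q))
      (W := Polynomial.aeval xF ((Polynomial.X - Polynomial.C (e j₁)) * w)) (y := y) (z := z)
      (a := a) (b := b)
      (by rw [← map_ofNat (algebraMap K F) 2]; exact (map_ne_zero (algebraMap K F)).2 h2)
      (by rw [← map_pow, hi]; simp)
      (by simpa [← IsScalarTower.algebraMap_apply K F L] using hcL)
      (by simpa [xF, Subtype.ext_iff] using hx0) (by simpa [Subtype.ext_iff] using hB0)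
      (haeval0 _ (mul_ne_zero (Polynomial.X_sub_C_ne_zero _) hQ0))
      (by
        apply (algebraMap F L).injective
        rw [haeval, hAB]
        simp [xF])
      (by rw [haeval]; exact hyz) hgen hy
      (haeval0 _ (mul_ne_zero (Polynomial.X_sub_C_ne_zero _) hw0))
      (by
        rw [haeval, ← IsScalarTower.algebraMap_apply K F L]
        simp only [w, map_mul, map_sub, Polynomial.aeval_X, Polynomial.aeval_C, map_inv₀]
        rw [mul_left_comm, hab]
        field_simp)
    have hstL (u : Polynomial K) (h : s ^ 2 - algebraMap K F c * t ^ 2 = Polynomial.aeval xF u) :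
        (s : L) ^ 2 - algebraMap K L c * (t : L) ^ 2 = Polynomial.aeval x u := by
      rw [← haeval, ← h]
      simp
    rcases hst with hst | hst
    · exact sq_sub_mul_sq_ne_aeval hc hx s.2 t.2 hw₁ (hstL _ hst)
    · rw [← map_mul] at hst
      have := hstL _ hst
      rw [mul_left_comm] at this
      refine sq_sub_mul_sq_ne_aeval hc hx s.2 t.2 ?_ this
      rw [Polynomial.eval_mul]
      exact mul_ne_zero hw₃ hQ
  have hprod := exists_prod_eq_sq_sub_mul_sq F.toSubfield (x := x) (c := algebraMap K L c) hxF
    (F.algebraMap_mem c) (fun j => algebraMap K L (ε j)) (fun j => F.algebraMap_mem _)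
    (Finset.univ : Finset ι)
  have hpe : ∏ j, (algebraMap K L (ε j) ^ 2 * algebraMap K L c - x) = Polynomial.aeval x P := by
    rw [hPx]
    simp [heε]
  rw [hpe] at hprod
  have hgenF := IntermediateField.adjoin_adjoin_simple_eq_top hgen
  rcases Nat.even_or_odd (Finset.univ : Finset ι).card with hev | hodd
  · obtain ⟨A, hA, B, hB, hAB⟩ := hprod.1 hev
    exact main (-P₃) (by simpa using hP₃) A B hA hB (by rw [← hP, hAB]) y z hy
      (by rw [← hP, hPx, heq]) hgenF
  · obtain ⟨A, hA, B, hB, hAB⟩ := hprod.2 hodd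
    have hz : Transcendental F z := by
      intro hz
      refine hy (IsAlgebraic.of_pow two_pos ?_)
      have : y ^ 2 = x⁻¹ * (Polynomial.aeval x P - z ^ 2) := by
        rw [hPx, ← heq]; field_simp; ring
      rw [this]
      have h1 : IsAlgebraic F x⁻¹ := isAlgebraic_algebraMap (⟨x⁻¹, inv_mem hxF⟩ : F)
      have h2 : IsAlgebraic F (Polynomial.aeval x P) := by
        have := (Polynomial.aeval_algebraMap_apply L (⟨x, hxF⟩ : F) P)
        rw [IntermediateField.algebraMap_apply] at this
        rw [this]
        exact isAlgebraic_algebraMap _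
      exact h1.mul (h2.sub (hz.pow 2))
    refine main (Polynomial.X * -P₃) (by simpa using ⟨he₃, hP₃⟩)
      (algebraMap K L i * x * B) (algebraMap K L i * A)
      (mul_mem (mul_mem (F.algebraMap_mem _) hxF) hB) (mul_mem (F.algebraMap_mem _) hA) ?_
      z (x * y) hz ?_ ?_
    · rw [mul_left_comm, ← hP, map_mul, hAB, Polynomial.aeval_X]
      have hi' : algebraMap K L i ^ 2 = -1 := by rw [← map_pow, hi]; simp
      linear_combination (x * algebraMap K L c * A ^ 2 - x ^ 2 * B ^ 2) * hi'
    · rw [mul_left_comm, ← hP, map_mul, hPx, ← heq, Polynomial.aeval_X]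
      ring
    · rw [eq_top_iff, ← hgenF, IntermediateField.adjoin_le_iff]
      have hzm : z ∈ IntermediateField.adjoin F {z, x * y} :=
        IntermediateField.subset_adjoin F _ (by simp)
      have hxym : x * y ∈ IntermediateField.adjoin F {z, x * y} :=
        IntermediateField.subset_adjoin F _ (by simp)
      have hxm : x ∈ IntermediateField.adjoin F {z, x * y} :=
        (IntermediateField.adjoin F {z, x * y}).algebraMap_mem ⟨x, hxF⟩
      rintro v (rfl | rfl)
      · have := div_mem hxym hxm
        rwa [mul_div_cancel_left₀ _ hx0] at this
      · exact hzm

theorem exists_pow_two_pow_eq_and_not_square {M : Type*} [Monoid M] {f : M} (k : ℕ)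
    (h : ¬ ∃ r : M, r ^ 2 ^ (k + 1) = f) :
    ∃ j ≤ k, ∃ b : M, b ^ 2 ^ j = f ∧ ∀ s : M, s ^ 2 ≠ b := by
  induction k with
  | zero => exact ⟨0, le_rfl, f, by simp, fun s hs => h ⟨s, by simpa using hs⟩⟩
  | succ k ih =>
    by_cases h' : ∃ r : M, r ^ 2 ^ (k + 1) = f
    · obtain ⟨r, hr⟩ := h'
      refine ⟨k + 1, le_rfl, r, hr, fun s hs => h ⟨s, ?_⟩⟩
      rw [pow_succ' 2 (k + 1), pow_mul, hs, hr]
    · obtain ⟨j, hj, b, hb⟩ := ih h'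
      exact ⟨j, hj.trans k.le_succ, b, hb⟩

theorem Polynomial.exists_irreducible_dvd_odd_natDegree {K : Type*} [Field K] (p : Polynomial K)
    (hp : Odd p.natDegree) : ∃ q, Irreducible q ∧ q ∣ p ∧ Odd q.natDegree := by
  have hp0 : p ≠ 0 := by rintro rfl; simp at hp
  revert hp
  induction p using WfDvdMonoid.induction_on_irreducible with
  | zero => exact absurd rfl hp0
  | unit u hu => simp [Polynomial.natDegree_eq_zero_of_isUnit hu]
  | mul a q ha hq ih =>
    intro hp
    rw [Polynomial.natDegree_mul hq.ne_zero ha, Nat.odd_add'] at hp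
    by_cases hqd : Odd q.natDegree
    · exact ⟨q, hq, dvd_mul_right _ _, hqd⟩
    · have : Odd a.natDegree := by
        rw [hp, ← Nat.not_odd_iff_even]; exact hqd
      obtain ⟨r, hr, hra, hrd⟩ := ih ha this
      exact ⟨r, hr, hra.mul_left _, hrd⟩

theorem sq_ne_algebraMap_of_odd_finrank {K M : Type*} [Field K] [Field M] [Algebra K M]
    [FiniteDimensional K M] (hodd : Odd (Module.finrank K M)) {b : K} (hb : ∀ s : K, s ^ 2 ≠ b)
    (s : M) : s ^ 2 ≠ algebraMap K M b := by
  intro hs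
  have hint : IsIntegral K s := IsIntegral.of_finite K s
  have hd : Odd (minpoly K s).natDegree := hodd.of_dvd_nat (minpoly.degree_dvd hint)
  have hle : (minpoly K s).natDegree ≤ 2 := by
    have hdvd : minpoly K s ∣ Polynomial.X ^ 2 - Polynomial.C b :=
      minpoly.dvd K s (by simp [hs])
    have := Polynomial.natDegree_le_of_dvd hdvd (Polynomial.X_pow_sub_C_ne_zero two_pos b)
    rwa [Polynomial.natDegree_X_pow_sub_C] at this
  have h1 : (minpoly K s).natDegree = 1 := by
    obtain ⟨t, ht⟩ := hd
    omega
  obtain ⟨r, rfl⟩ := minpoly.natDegree_eq_one_iff.1 h1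
  refine hb r ((algebraMap K M).injective ?_)
  rw [map_pow, hs]

theorem exists_odd_root_not_square {K Ω : Type*} [Field K] [Field Ω] [IsAlgClosed Ω] [Algebra K Ω]
    {b : K} (hb : ∀ s : K, s ^ 2 ≠ b) {m : ℕ} (hm : Odd m) :
    ∃ K' : IntermediateField K Ω, K' ≤ algebraicClosure K Ω ∧ ∃ c ∈ K', c ^ m = algebraMap K Ω b ∧
      ∀ s ∈ K', s ^ 2 ≠ c := by
  obtain ⟨q, hq, hqd, hqo⟩ := Polynomial.exists_irreducible_dvd_odd_natDegree
    (Polynomial.X ^ m - Polynomial.C b) (by rwa [Polynomial.natDegree_X_pow_sub_C])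
  obtain ⟨c, hc⟩ := IsAlgClosed.exists_aeval_eq_zero Ω q
    (Polynomial.degree_pos_of_irreducible hq).ne'
  have hcm : c ^ m = algebraMap K Ω b := by
    have := Polynomial.aeval_eq_zero_of_dvd_aeval_eq_zero hqd hc
    simpa [sub_eq_zero] using this
  have hint : IsIntegral K c := IsAlgebraic.isIntegral ⟨q, hq.ne_zero, hc⟩
  have hfd : FiniteDimensional K (IntermediateField.adjoin K {c}) :=
    IntermediateField.adjoin.finiteDimensional hint
  have hfin : Odd (Module.finrank K (IntermediateField.adjoin K {c})) := by
    rw [IntermediateField.adjoin.finrank hint, ← minpoly.eq_of_irreducible hq hc,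
      Polynomial.natDegree_mul hq.ne_zero (by simpa using hq.ne_zero), Polynomial.natDegree_C,
      add_zero]
    exact hqo
  refine ⟨IntermediateField.adjoin K {c}, ?_, c, IntermediateField.mem_adjoin_simple_self K c,
    hcm, fun s hs hsc => ?_⟩
  · rw [IntermediateField.adjoin_simple_le_iff]
    exact mem_algebraicClosure_iff.2 hint.isAlgebraic
  · refine sq_ne_algebraMap_of_odd_finrank hfin hb
      (⟨s, hs⟩ ^ m : IntermediateField.adjoin K {c}) (Subtype.ext ?_)
    change (s ^ m) ^ 2 = algebraMap K Ω b
    rw [← pow_mul, mul_comm, pow_mul, hsc, hcm]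

theorem sq_ne_sqrt_of_mem_adjoin {F Λ : Type*} [Field F] [Field Λ] [Algebra F Λ] {c i : F}
    (hi : i ^ 2 = -1) (hc : ∀ s : F, s ^ 2 ≠ c) {r : Λ} (hr : r ^ 2 = algebraMap F Λ c) {w : Λ}
    (hw : w ∈ IntermediateField.adjoin F {r}) : w ^ 2 ≠ r := by
  intro h
  obtain ⟨s, t, rfl⟩ := IntermediateField.exists_eq_add_mul_of_mem_adjoin hr hw
  have h' : algebraMap F Λ (s ^ 2 + t ^ 2 * c) = r * algebraMap F Λ (1 - 2 * s * t) := by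
    simp only [map_add, map_mul, map_sub, map_pow, map_one, map_ofNat]
    linear_combination h - algebraMap F Λ t ^ 2 * hr
  have hlin : 1 - 2 * s * t = 0 := by
    by_contra hne
    refine hc ((s ^ 2 + t ^ 2 * c) / (1 - 2 * s * t)) ((algebraMap F Λ).injective ?_)
    have hne' : algebraMap F Λ (1 - 2 * s * t) ≠ 0 := (map_ne_zero _).2 hne
    rw [map_pow, map_div₀, h', mul_div_cancel_right₀ _ hne', hr]
  have ht : t ≠ 0 := by
    rintro rfl
    simp at hlin
  rw [hlin, map_zero, mul_zero, map_eq_zero] at h'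
  refine hc (i * s / t) ?_
  field_simp
  linear_combination s ^ 2 * hi - h'

theorem exists_two_pow_root_not_square {K Ω : Type*} [Field K] [Field Ω] [IsAlgClosed Ω]
    [Algebra K Ω] {i : K} (hi : i ^ 2 = -1) (l : ℕ) (K₀ : IntermediateField K Ω)
    (hK₀ : K₀ ≤ algebraicClosure K Ω) {b : Ω} (hbK : b ∈ K₀) (hb : ∀ s ∈ K₀, s ^ 2 ≠ b) :
    ∃ K' : IntermediateField K Ω, K' ≤ algebraicClosure K Ω ∧ ∃ c ∈ K', c ^ 2 ^ l = b ∧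
      ∀ s ∈ K', s ^ 2 ≠ c := by
  induction l generalizing K₀ b with
  | zero => exact ⟨K₀, hK₀, b, hbK, by simp, hb⟩
  | succ l ih =>
    obtain ⟨r, hr⟩ := IsAlgClosed.exists_pow_nat_eq b two_pos
    have hr' : r ^ 2 = algebraMap K₀ Ω ⟨b, hbK⟩ := hr
    have hralg : r ∈ algebraicClosure K Ω := by
      refine mem_algebraicClosure_iff.2 (IsAlgebraic.of_pow two_pos ?_)
      rw [hr]
      exact mem_algebraicClosure_iff.1 (hK₀ hbK)
    obtain ⟨K', hK', c, hcK, hc, hcs⟩ := ih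
      ((IntermediateField.adjoin K₀ {r}).restrictScalars K) (b := r) (fun w hw => by
        obtain ⟨s, t, rfl⟩ := IntermediateField.exists_eq_add_mul_of_mem_adjoin hr' hw
        exact add_mem (hK₀ s.2) (mul_mem hralg (hK₀ t.2)))
      (IntermediateField.mem_adjoin_simple_self K₀ r)
      (fun w hw => sq_ne_sqrt_of_mem_adjoin (i := algebraMap K K₀ i)
        (by rw [← map_pow, hi]; simp)
        (fun s hs => hb s s.2 (by simpa using congrArg Subtype.val hs)) hr' hw)
    exact ⟨K', hK', c, hcK, by rw [pow_succ, pow_mul, hc, hr], hcs⟩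

theorem exists_root_not_square {K Ω : Type*} [Field K] [Field Ω] [IsAlgClosed Ω] [Algebra K Ω]
    {i : K} (hi : i ^ 2 = -1) {f : K} {k m : ℕ} (hm : Odd m)
    (hf : ¬ ∃ r : K, r ^ 2 ^ (k + 1) = f) :
    ∃ K' : IntermediateField K Ω, K' ≤ algebraicClosure K Ω ∧ ∃ c ∈ K',
      c ^ (2 ^ k * m) = algebraMap K Ω f ∧ ∀ s ∈ K', s ^ 2 ≠ c := by
  obtain ⟨j, hj, b, hbf, hb⟩ := exists_pow_two_pow_eq_and_not_square k hf
  obtain ⟨K₀, hK₀, c₀, hc₀K, hc₀, hc₀s⟩ := exists_odd_root_not_square (Ω := Ω) hb hm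
  obtain ⟨K', hK', c, hcK, hc, hcs⟩ := exists_two_pow_root_not_square hi (k - j) K₀ hK₀ hc₀K hc₀s
  refine ⟨K', hK', c, hcK, ?_, hcs⟩
  rw [← hbf, map_pow, ← hc₀, ← hc, ← pow_mul, ← pow_mul]
  congr 1
  rw [← Nat.sub_add_cancel hj, pow_add]
  simp
  ring

theorem AlgebraicIndependent.transcendental_adjoin_pair {K L : Type*} [Field K] [Field L]
    [Algebra K L] {x y : L} (h : AlgebraicIndependent K ![x, y]) :
    Transcendental (IntermediateField.adjoin K {x}) y := by
  rw [IntermediateField.transcendental_adjoin_iff]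
  have := h.transcendental_adjoin (s := {0}) (i := 1) (by simp)
  rwa [show ![x, y] '' {0} = {x} by simp] at this

theorem IsPrimitiveRoot.exists_sq_eq_of_mem_nthRootsFinset {K : Type*} [Field K] {η : K} {N : ℕ}
    (hN : 0 < N) (hη : IsPrimitiveRoot η (2 * N)) {μ : K}
    (hμ : μ ∈ Polynomial.nthRootsFinset N (1 : K)) : ∃ ε : K, ε ≠ 0 ∧ ε ^ 2 = μ := by
  have hζ : IsPrimitiveRoot (η ^ 2) N := hη.pow (by positivity) rfl
  have : NeZero N := ⟨hN.ne'⟩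
  obtain ⟨j, -, rfl⟩ := hζ.eq_pow_of_pow_eq_one ((Polynomial.mem_nthRootsFinset hN 1).1 hμ)
  exact ⟨η ^ j, pow_ne_zero _ (hη.ne_zero (by positivity)), by ring⟩

theorem adjoin_ne_top_of_not_isSquare {σ K L : Type*} [Field K]
    [Field L] [Algebra (MvPolynomial σ K) L] [Algebra K L] [IsScalarTower K (MvPolynomial σ K) L]
    [IsFractionRing (MvPolynomial σ K) L] (h2 : (2 : K) ≠ 0)
    {c i η : K} (hc : ∀ r : K, r ^ 2 ≠ c) (hi : i ^ 2 = -1) {N : ℕ} (hN : 3 ≤ N)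
    (hη : IsPrimitiveRoot η (2 * N)) {x y z : L} (hxy : AlgebraicIndependent K ![x, y])
    (heq : z ^ 2 + x * y ^ 2 = algebraMap K L c ^ N - x ^ N) :
    IntermediateField.adjoin K {x, y, z} ≠ ⊤ := by
  have hN0 : 0 < N := by omega
  have hζ : IsPrimitiveRoot (η ^ 2) N := hη.pow (by positivity) rfl
  have hx : Transcendental K x := hxy.transcendental 0
  have hc0 : c ≠ 0 := by
    rintro rfl
    exact hc 0 (by simp)
  choose ε hε0 hε using fun μ : Polynomial.nthRootsFinset N (1 : K) =>
    hη.exists_sq_eq_of_mem_nthRootsFinset hN0 μ.2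
  have hprod : ∏ j : Polynomial.nthRootsFinset N (1 : K), (algebraMap K L (j * c) - x) =
      (-1) ^ N * (x ^ N - algebraMap K L c ^ N) := by
    have hcL : algebraMap K L c ≠ 0 := by simpa using hc0
    have hpoly := congrArg (Polynomial.aeval (x / algebraMap K L c))
      (Polynomial.X_pow_sub_one_eq_prod hN0 hζ)
    simp only [map_sub, map_pow, map_one, map_prod, Polynomial.aeval_X, Polynomial.aeval_C] at hpoly
    have hx' : x ^ N - algebraMap K L c ^ N =
        algebraMap K L c ^ N * ((x / algebraMap K L c) ^ N - 1) := by
      rw [div_pow]; field_simp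
    have hpow (d : L) : d ^ N = ∏ _j ∈ Polynomial.nthRootsFinset N (1 : K), d := by
      rw [Finset.prod_const, hζ.card_nthRootsFinset]
    rw [Finset.prod_coe_sort _ fun j => algebraMap K L (j * c) - x, hx', hpoly, ← mul_assoc,
      ← mul_pow, hpow, ← Finset.prod_mul_distrib]
    refine Finset.prod_congr rfl fun j _ => ?_
    rw [map_mul]
    field_simp
    ring
  have hi0 : i ≠ 0 := by
    rintro rfl
    norm_num at hi
  set u : L := algebraMap K L (i ^ (N + 1)) with hu
  have hu0 : u ≠ 0 := by simpa [hu] using hi0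
  have hu2 : u ^ 2 = (-1) ^ (N + 1) := by
    rw [hu, ← map_pow, ← pow_mul, mul_comm, pow_mul, hi]; simp
  intro hgen
  refine not_generates_of_not_isSquare (σ := σ) (L := L) (x := x) (y := u * y) (z := u * z)
    (e := fun j : Polynomial.nthRootsFinset N (1 : K) => j * c) (ε := ε) h2 hc hi
    (fun j j' h => Subtype.ext (mul_right_cancel₀ hc0 h)) hε0 (fun j => by rw [hε]) ?_ hx ?_ ?_ ?_
  · rw [Fintype.card_coe, hζ.card_nthRootsFinset]
    exact hN
  · intro h
    refine hxy.transcendental_adjoin_pair ?_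
    have h1 : IsAlgebraic (IntermediateField.adjoin K {x}) u⁻¹ := by
      have := isAlgebraic_algebraMap (A := L)
        (algebraMap K (IntermediateField.adjoin K {x}) (i ^ (N + 1)))
      rw [← IsScalarTower.algebraMap_apply] at this
      exact this.inv
    have := h1.mul h
    rwa [inv_mul_cancel_left₀ hu0] at this
  · rw [hprod]
    linear_combination u ^ 2 * heq + (algebraMap K L c ^ N - x ^ N) * hu2
  · rw [eq_top_iff, ← hgen, IntermediateField.adjoin_le_iff]
    have hum : u ∈ IntermediateField.adjoin K {x, u * y, u * z} := algebraMap_mem _ _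
    have hmem (w : L) (hw : u * w ∈ IntermediateField.adjoin K {x, u * y, u * z}) :
        w ∈ IntermediateField.adjoin K {x, u * y, u * z} := by
      have := mul_mem (inv_mem hum) hw
      rwa [inv_mul_cancel_left₀ hu0] at this
    rintro w (rfl | rfl | rfl)
    · exact IntermediateField.subset_adjoin K _ (by simp)
    · exact hmem _ (IntermediateField.subset_adjoin K _ (by simp))
    · exact hmem _ (IntermediateField.subset_adjoin K _ (by simp))

theorem AlgebraicIndependent.of_adjoin_pair_eq_top {K L : Type*} [Field K] [Field L] [Algebra K L]
    {x y g h : L} (hxy : AlgebraicIndependent K ![x, y])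
    (hgh : IntermediateField.adjoin K {g, h} = ⊤) : AlgebraicIndependent K ![g, h] := by
  have hr : Set.range ![g, h] = {g, h} := by simp [Set.pair_comm]
  have halg : Algebra.IsAlgebraic (Algebra.adjoin K (Set.range ![g, h])) L := by
    rw [← IntermediateField.isAlgebraic_adjoin_iff_top, hr, hgh]
    exact ⟨fun w => isAlgebraic_algebraMap (⟨w, trivial⟩ : (⊤ : IntermediateField K L))⟩
  exact (Algebra.IsAlgebraic.isTranscendenceBasis_of_lift_le_trdeg_of_finite K ![g, h]
    hxy.lift_cardinalMk_le_trdeg).1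

/-- If the surface `z² + x y² = f - x ^ N` is rational over `K`, then `f` is a
`2 ^ (k + 1)`-th power
in `K`, where `2 ^ k` is the largest power of two dividing `N`. -/
theorem exists_pow_eq_of_adjoin_pair_eq_top {K L : Type*} [Field K] [Field L] [Algebra K L]
    (h2 : (2 : K) ≠ 0) {i η f : K} (hi : i ^ 2 = -1) {k m : ℕ} (hm : Odd m)
    (hN : 3 ≤ 2 ^ k * m) (hη : IsPrimitiveRoot η (2 * (2 ^ k * m))) {x y z : L}
    (hxy : AlgebraicIndependent K ![x, y])
    (heq : z ^ 2 + x * y ^ 2 = algebraMap K L f - x ^ (2 ^ k * m))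
    {g h : L} (hgh : IntermediateField.adjoin K {g, h} = ⊤)
    (hgen : IntermediateField.adjoin K {x, y, z} = ⊤) :
    ∃ r : K, r ^ 2 ^ (k + 1) = f := by
  by_contra hf
  obtain ⟨K', hK', c, hcK, hcf, hc⟩ := exists_root_not_square (Ω := AlgebraicClosure L) hi hm hf
  have halg : Algebra.IsAlgebraic K K' := ⟨fun w => by
    have := mem_algebraicClosure_iff.1 (hK' w.2)
    exact (isAlgebraic_algebraMap_iff (algebraMap K' (AlgebraicClosure L)).injective).1 this⟩
  let j : L →ₐ[K] AlgebraicClosure L := IsScalarTower.toAlgHom K L (AlgebraicClosure L)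
  have hind {v w : L} (hvw : AlgebraicIndependent K ![v, w]) :
      AlgebraicIndependent K' ![j v, j w] := by
    have := (hvw.map' (f := j) j.injective).extendScalars K'
    convert this using 1
    ext t
    fin_cases t <;> rfl
  have hgh' := hind (hxy.of_adjoin_pair_eq_top hgh)
  set E := IntermediateField.adjoin K' (Set.range ![j g, j h]) with hE
  have hmem (w : L) : j w ∈ E := by
    have hle : IntermediateField.adjoin K {g, h} ≤ (E.restrictScalars K).comap j := by
      rw [IntermediateField.adjoin_le_iff]
      rintro w (rfl | rfl)
      · exact IntermediateField.subset_adjoin K' _ ⟨0, rfl⟩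
      · exact IntermediateField.subset_adjoin K' _ ⟨1, rfl⟩
    rw [hgh] at hle
    exact hle (IntermediateField.mem_top (x := w))
  let φ : L → FractionRing (MvPolynomial (Fin 2) K') := fun w =>
    hgh'.aevalEquivField.symm ⟨j w, hmem w⟩
  have hφ (w : L) : (hgh'.aevalEquivField (φ w) : AlgebraicClosure L) = j w := by
    simp only [φ, AlgEquiv.apply_symm_apply]
  have hinj : Function.Injective ((E.val).comp hgh'.aevalEquivField.toAlgHom) :=
    (E.val.comp hgh'.aevalEquivField.toAlgHom).injective
  refine adjoin_ne_top_of_not_isSquare (σ := Fin 2) (K := K') (c := ⟨c, hcK⟩)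
    (i := algebraMap K K' i) (η := algebraMap K K' η) (x := φ x) (y := φ y) (z := φ z) ?_ ?_ ?_
    hN (hη.map_of_injective (algebraMap K K').injective) ?_ ?_ ?_
  · rw [← map_ofNat (algebraMap K K') 2]
    exact (map_ne_zero _).2 h2
  · exact fun s hs => hc s s.2 (by simpa using congrArg Subtype.val hs)
  · rw [← map_pow, hi]; simp
  · refine AlgebraicIndependent.of_comp ((E.val).comp hgh'.aevalEquivField.toAlgHom) ?_
    convert hind hxy using 1
    ext t
    fin_cases t
    · exact hφ x
    · exact hφ y
  · apply hinj
    have hc' : ((E.val).comp hgh'.aevalEquivField.toAlgHom)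
      (algebraMap K' (FractionRing (MvPolynomial (Fin 2) K')) ⟨c, hcK⟩) = c := by
      rw [AlgHom.commutes]; rfl
    have hφ' (w : L) : ((E.val).comp hgh'.aevalEquivField.toAlgHom) (φ w) = j w := hφ w
    simp only [map_add, map_sub, map_mul, map_pow, hφ', hc']
    rw [hcf, IsScalarTower.algebraMap_apply K L (AlgebraicClosure L)]
    have := congrArg j heq
    simp only [map_add, map_sub, map_mul, map_pow] at this
    exact this
  · set A := IntermediateField.adjoin K' {φ x, φ y, φ z}
    set ψ := (E.val).comp hgh'.aevalEquivField.toAlgHom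
    have hmemA {w : L} (hw : φ w ∈ A) : j w ∈ A.map ψ := ⟨φ w, hw, hφ w⟩
    have hle : IntermediateField.adjoin K {x, y, z} ≤ ((A.map ψ).restrictScalars K).comap j := by
      rw [IntermediateField.adjoin_le_iff]
      rintro w (rfl | rfl | rfl) <;>
        exact hmemA (IntermediateField.subset_adjoin K' _ (by simp))
    rw [hgen] at hle
    have hEA : E ≤ A.map ψ := by
      rw [hE, IntermediateField.adjoin_le_iff]
      rintro _ ⟨t, rfl⟩
      fin_cases t
      · exact hle (IntermediateField.mem_top (x := g))
      · exact hle (IntermediateField.mem_top (x := h))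
    rw [eq_top_iff]
    intro w _
    obtain ⟨w', hw', hww⟩ := hEA (hgh'.aevalEquivField w).2
    rwa [← hinj hww]

theorem exists_prod_sq_sub_mul_sq_eq {F ι : Type*} [CommRing F] (x ρ : F) (s : Finset ι)
    (v : ι → F) : ∃ A B : F, ∏ j ∈ s, (ρ ^ 2 - x * v j ^ 2) = A ^ 2 - x * B ^ 2 := by
  classical
  induction s using Finset.induction_on with
  | empty => exact ⟨1, 0, by simp⟩
  | insert j s hj ih =>
    obtain ⟨A, B, h⟩ := ih
    exact ⟨ρ * A + x * v j * B, ρ * B + v j * A, by rw [Finset.prod_insert hj, h]; ring⟩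

theorem exists_pow_sub_pow_eq_sq_sub_mul_sq {F : Type*} [Field F] {η : F} {k m : ℕ} (hm : Odd m)
    (hη : IsPrimitiveRoot η (2 * 2 ^ k)) (x ρ : F) :
    ∃ A B : F, ρ ^ 2 ^ (k + 1) - x ^ (2 ^ k * m) = A ^ 2 - x * B ^ 2 := by
  have hζ : IsPrimitiveRoot (η ^ 2) (2 ^ k) := hη.pow (by positivity) rfl
  obtain ⟨l, rfl⟩ := hm
  choose ε _ hε using fun μ : Polynomial.nthRootsFinset (2 ^ k) (1 : F) =>
    hη.exists_sq_eq_of_mem_nthRootsFinset (by positivity) μ.2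
  obtain ⟨A, B, h⟩ := exists_prod_sq_sub_mul_sq_eq x ρ Finset.univ fun μ => ε μ * x ^ l
  refine ⟨A, B, ?_⟩
  rw [← h, pow_succ', pow_mul, mul_comm, pow_mul, mul_comm,
    hζ.pow_sub_pow_eq_prod_sub_mul _ _ (by positivity),
    ← Finset.prod_coe_sort]
  refine Finset.prod_congr rfl fun μ _ => ?_
  rw [← hε]
  ring

theorem exists_adjoin_simple_eq_top_of_conic {F L : Type*} [Field F] [Field L] [Algebra F L]
    (h2 : (2 : F) ≠ 0) {i x A B : F} (hi : i ^ 2 = -1) (hx : x ≠ 0) (hAB : A ^ 2 - x * B ^ 2 ≠ 0)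
    {y z : L} (hyz : z ^ 2 + algebraMap F L x * y ^ 2 = algebraMap F L (A ^ 2 - x * B ^ 2))
    (hgen : IntermediateField.adjoin F {y, z} = ⊤) :
    ∃ θ : L, IntermediateField.adjoin F {θ} = ⊤ := by
  have hxL : algebraMap F L x ≠ 0 := by simpa using hx
  have hiL : algebraMap F L i ^ 2 = -1 := by rw [← map_pow, hi]; simp
  have h2L : (2 : L) ≠ 0 := by
    rw [← map_ofNat (algebraMap F L) 2]
    exact (map_ne_zero _).2 h2
  have hABL : algebraMap F L A ^ 2 - algebraMap F L x * algebraMap F L B ^ 2 ≠ 0 := by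
    simpa using (map_ne_zero (algebraMap F L)).2 hAB
  simp only [map_sub, map_mul, map_pow] at hyz
  suffices ∃ θ : L, ∀ M : IntermediateField F L, θ ∈ M → y ∈ M ∧ z ∈ M by
    obtain ⟨θ, hθ⟩ := this
    refine ⟨θ, ?_⟩
    rw [eq_top_iff, ← hgen, IntermediateField.adjoin_le_iff]
    have := hθ _ (IntermediateField.mem_adjoin_simple_self F θ)
    rintro w (rfl | rfl)
    · exact this.1
    · exact this.2
  by_cases hzA : z = algebraMap F L A
  · refine ⟨0, fun M _ => ⟨?_, hzA ▸ M.algebraMap_mem _⟩⟩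
    have hy : (y - algebraMap F L (i * B)) * (y + algebraMap F L (i * B)) = 0 := by
      refine (mul_eq_zero_iff_left hxL).1 ?_
      rw [map_mul]
      rw [hzA] at hyz
      linear_combination hyz - algebraMap F L x * algebraMap F L B ^ 2 * hiL
    rcases mul_eq_zero.1 hy with h | h
    · rw [sub_eq_zero.1 h]
      exact M.algebraMap_mem _
    · rw [eq_neg_of_add_eq_zero_left h]
      exact neg_mem (M.algebraMap_mem _)
  · have hzA' : z - algebraMap F L A ≠ 0 := sub_ne_zero.2 hzA
    obtain ⟨θ, hθ⟩ : ∃ θ : L, y + algebraMap F L i * algebraMap F L B =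
        θ * (z - algebraMap F L A) :=
      ⟨(y + algebraMap F L i * algebraMap F L B) / (z - algebraMap F L A), by field_simp⟩
    have hz : z = -algebraMap F L A - algebraMap F L x * θ *
        (y - algebraMap F L i * algebraMap F L B) := by
      apply mul_right_cancel₀ hzA'
      linear_combination hyz - algebraMap F L x * (y - algebraMap F L i * algebraMap F L B) * hθ
        - algebraMap F L x * algebraMap F L B ^ 2 * hiL
    have hy : y * (1 + algebraMap F L x * θ ^ 2) = -2 * θ * algebraMap F L A +
        algebraMap F L i * algebraMap F L B * (algebraMap F L x * θ ^ 2 - 1) := by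
      linear_combination hθ + θ * hz
    have hne : 1 + algebraMap F L x * θ ^ 2 ≠ 0 := by
      intro h0
      rw [h0, mul_zero] at hy
      have h1 : θ * algebraMap F L A = -(algebraMap F L i * algebraMap F L B) := by
        apply mul_left_cancel₀ h2L
        linear_combination hy + algebraMap F L i * algebraMap F L B * h0
      apply hABL
      linear_combination algebraMap F L A ^ 2 * h0 - algebraMap F L x * (θ * algebraMap F L A -
        algebraMap F L i * algebraMap F L B) * h1 - algebraMap F L x * algebraMap F L B ^ 2 * hiL
    refine ⟨θ, fun M hM => ?_⟩
    have hm (w : F) : algebraMap F L w ∈ M := M.algebraMap_mem w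
    have hyM : y ∈ M := by
      rw [eq_div_of_mul_eq hne hy]
      have h2M : (-2 : L) ∈ M := by exact_mod_cast intCast_mem M (-2)
      exact div_mem (add_mem (mul_mem (mul_mem h2M hM) (hm _))
        (mul_mem (mul_mem (hm _) (hm _)) (sub_mem (mul_mem (hm _) (pow_mem hM 2)) (one_mem M))))
        (add_mem (one_mem M) (mul_mem (hm _) (pow_mem hM 2)))
    refine ⟨hyM, ?_⟩
    rw [hz]
    exact sub_mem (neg_mem (hm _))
      (mul_mem (mul_mem (hm _) hM) (sub_mem hyM (mul_mem (hm _) (hm _))))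

/-- If `f` is a `2 ^ (k + 1)`-th power in `K`, then the surface `z² + x y² = f - x ^ (2 ^ k * m)`
with `m` odd is rational over `K`. -/
theorem exists_adjoin_pair_eq_top_of_pow_eq {K L : Type*} [Field K] [Field L] [Algebra K L]
    (h2 : (2 : K) ≠ 0) {i η f ρ : K} (hi : i ^ 2 = -1) {k m : ℕ} (hm : Odd m)
    (hη : IsPrimitiveRoot η (2 * 2 ^ k)) (hρ : ρ ^ 2 ^ (k + 1) = f) {x y z : L}
    (hx : Transcendental K x)
    (heq : z ^ 2 + x * y ^ 2 = algebraMap K L f - x ^ (2 ^ k * m))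
    (hgen : IntermediateField.adjoin K {x, y, z} = ⊤) :
    ∃ g h : L, IntermediateField.adjoin K {g, h} = ⊤ := by
  set F := IntermediateField.adjoin K {x}
  have hxF : x ∈ F := IntermediateField.mem_adjoin_simple_self K x
  let xF : F := ⟨x, hxF⟩
  obtain ⟨A, B, hAB⟩ := exists_pow_sub_pow_eq_sq_sub_mul_sq hm
    (hη.map_of_injective (algebraMap K F).injective) xF (algebraMap K F ρ)
  rw [← map_pow, hρ] at hAB
  have hABL : algebraMap F L (A ^ 2 - xF * B ^ 2) = algebraMap K L f - x ^ (2 ^ k * m) := by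
    rw [← hAB, map_sub, ← IsScalarTower.algebraMap_apply, map_pow]
    rfl
  have hne : A ^ 2 - xF * B ^ 2 ≠ 0 := by
    intro h0
    rw [h0, map_zero] at hABL
    refine hx (IsAlgebraic.of_pow (n := 2 ^ k * m) (by have := hm.pos; positivity) ?_)
    rw [← sub_eq_zero.1 hABL.symm]
    exact isAlgebraic_algebraMap f
  have hx0 : xF ≠ 0 := by
    intro h0
    have : x = 0 := congrArg Subtype.val h0
    exact hx (this ▸ isAlgebraic_zero)
  obtain ⟨θ, hθ⟩ := exists_adjoin_simple_eq_top_of_conic (F := F) (L := L) (y := y) (z := z)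
    (by rw [← map_ofNat (algebraMap K F) 2]; exact (map_ne_zero _).2 h2)
    (i := algebraMap K F i) (by rw [← map_pow, hi]; simp) hx0 hne (by rw [hABL]; exact heq)
    (IntermediateField.adjoin_adjoin_simple_eq_top hgen)
  refine ⟨x, θ, ?_⟩
  have := (IntermediateField.adjoin_adjoin_left K {x} {θ}).symm.trans
    (congrArg (IntermediateField.restrictScalars K) hθ)
  rwa [IntermediateField.restrictScalars_top, Set.singleton_union] at this

theorem adjoin_Vx_Vy_Vz : IntermediateField.adjoin ℂ {Vx, Vy, Vz} = ⊤ := by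
  rw [eq_top_iff]
  intro w _
  set E := IntermediateField.adjoin ℂ {Vx, Vy, Vz}
  have hpoly (p : MvPolynomial (Fin 3) ℂ) : algebraMap _ Fxyz p ∈ E := by
    induction p using MvPolynomial.induction_on with
    | C a =>
      rw [← MvPolynomial.algebraMap_eq, ← IsScalarTower.algebraMap_apply]
      exact E.algebraMap_mem a
    | add p q hp hq => rw [map_add]; exact add_mem hp hq
    | mul_X p t hp =>
      rw [map_mul]
      refine mul_mem hp (IntermediateField.subset_adjoin ℂ _ ?_)
      fin_cases t <;> simp [Vx, Vy, Vz]
  obtain ⟨p, q, -, rfl⟩ := IsFractionRing.div_surjective (A := MvPolynomial (Fin 3) ℂ) w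
  exact div_mem (hpoly p) (hpoly q)

theorem algebraicIndependent_Vx_Vy_Vz : AlgebraicIndependent ℂ ![Vx, Vy, Vz] := by
  have := (MvPolynomial.algebraicIndependent_X (Fin 3) ℂ).map'
    (f := IsScalarTower.toAlgHom ℂ (MvPolynomial (Fin 3) ℂ) Fxyz)
    (IsFractionRing.injective (MvPolynomial (Fin 3) ℂ) Fxyz)
  convert this using 1
  ext t
  fin_cases t <;> rfl

theorem algebraicIndependent_fDn_Vx_Vy (n : ℕ) : AlgebraicIndependent ℂ ![fDn n, Vx, Vy] := by
  have halg : Algebra.IsAlgebraic (Algebra.adjoin ℂ (Set.range ![fDn n, Vx, Vy])) Fxyz := by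
    rw [← IntermediateField.isAlgebraic_adjoin_iff_top]
    set M := IntermediateField.adjoin ℂ (Set.range ![fDn n, Vx, Vy])
    have hmem (t : Fin 3) : ![fDn n, Vx, Vy] t ∈ M :=
      IntermediateField.subset_adjoin ℂ _ ⟨t, rfl⟩
    have halgM {w : Fxyz} (hw : w ∈ M) : IsAlgebraic M w := isAlgebraic_algebraMap (⟨w, hw⟩ : M)
    have hle : IntermediateField.adjoin ℂ {Vx, Vy, Vz} ≤
        (algebraicClosure M Fxyz).restrictScalars ℂ := by
      rw [IntermediateField.adjoin_le_iff]
      rintro w (rfl | rfl | rfl)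
      · exact mem_algebraicClosure_iff.2 (halgM (hmem 1))
      · exact mem_algebraicClosure_iff.2 (halgM (hmem 2))
      · refine mem_algebraicClosure_iff.2 (IsAlgebraic.of_pow two_pos (halgM ?_))
        have hz : Vz ^ 2 = fDn n - Vx ^ (n - 1) - Vx * Vy ^ 2 := by
          rw [fDn]; ring
        rw [hz]
        exact sub_mem (sub_mem (hmem 0) (pow_mem (hmem 1) _))
          (mul_mem (hmem 1) (pow_mem (hmem 2) 2))
    rw [adjoin_Vx_Vy_Vz] at hle
    exact ⟨fun w => mem_algebraicClosure_iff.1 (hle (IntermediateField.mem_top (x := w)))⟩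
  exact (Algebra.IsAlgebraic.isTranscendenceBasis_of_lift_le_trdeg_of_finite ℂ
    ![fDn n, Vx, Vy] algebraicIndependent_Vx_Vy_Vz.lift_cardinalMk_le_trdeg).1

theorem algebraicIndependent_Vx_Vy (n : ℕ) : AlgebraicIndependent (CfDn n) ![Vx, Vy] := by
  have h := (algebraicIndependent_fDn_Vx_Vy n).adjoin_of_disjoint (s := {0}) (t := {1, 2}) (by simp)
  rw [show ![fDn n, Vx, Vy] '' {0} = {fDn n} by simp] at h
  have h' := IntermediateField.algebraicIndependent_adjoin_iff.2 h
  have h'' := h'.comp ![⟨1, by simp⟩, ⟨2, by simp⟩] (by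
    intro s t hst
    fin_cases s <;> fin_cases t <;> simp_all)
  have hfun : (fun t : ({1, 2} : Set (Fin 3)) => ![fDn n, Vx, Vy] t) ∘
      ![⟨1, by simp⟩, ⟨2, by simp⟩] = ![Vx, Vy] := by
    ext t
    fin_cases t <;> rfl
  rw [hfun] at h''
  exact h''

theorem IntermediateField.adjoin_eq_top_iff_closure {K L : Type*} [Field K] [Field L] [Algebra K L]
    (S : Set L) : Subfield.closure (Set.range (algebraMap K L) ∪ S) = ⊤ ↔
      IntermediateField.adjoin K S = ⊤ := by
  rw [← IntermediateField.toSubfield_injective.eq_iff]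
  rfl

theorem padicValNat_two_mul_two_pow_mul {k m : ℕ} (hm : Odd m) :
    padicValNat 2 (2 * (2 ^ k * m)) = k + 1 := by
  rw [← mul_assoc, ← pow_succ', padicValNat.mul (by positivity) hm.pos.ne',
    padicValNat.prime_pow, padicValNat.eq_zero_of_not_dvd hm.not_two_dvd_nat, add_zero]

theorem rational_iff_root_of_adjoin_range {n : ℕ} (hn : 4 ≤ n) {K L : Type*} [Field K]
    [Algebra (CfDn n) K] [FiniteDimensional (CfDn n) K] [Field L] [Algebra K L]
    [Algebra (CfDn n) L] [IsScalarTower (CfDn n) K L] (j : Fxyz →ₐ[CfDn n] L)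
    (hj : Algebra.adjoin K (Set.range j) = ⊤) :
    (∃ g h : L, Subfield.closure (Set.range (algebraMap K L) ∪ {g, h}) = ⊤) ↔
      ∃ ρ : K, ρ ^ (2 ^ (padicValNat 2 (2 * (n - 1)))) = algebraMap (CfDn n) K
          ⟨fDn n, IntermediateField.subset_adjoin ℂ {fDn n} rfl⟩ := by
  set f : CfDn n := ⟨fDn n, IntermediateField.subset_adjoin ℂ {fDn n} rfl⟩
  simp only [IntermediateField.adjoin_eq_top_iff_closure]
  obtain ⟨k, m, hm, hkm⟩ := Nat.exists_eq_two_pow_mul_odd (n := n - 1) (by omega)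
  let ι : ℂ →+* K := (algebraMap (CfDn n) K).comp (algebraMap ℂ (CfDn n))
  have h2 : (2 : K) ≠ 0 := by
    rw [← map_ofNat ι 2]
    exact (map_ne_zero ι).2 two_ne_zero
  have hi : ι Complex.I ^ 2 = -1 := by rw [← map_pow, Complex.I_sq]; simp
  have hroot (N : ℕ) (hN : N ≠ 0) : ∃ η : K, IsPrimitiveRoot η N :=
    ⟨_, (Complex.isPrimitiveRoot_exp N hN).map_of_injective ι.injective⟩
  have hxy : AlgebraicIndependent K ![j Vx, j Vy] := by
    have := ((algebraicIndependent_Vx_Vy n).map' (f := j) j.injective).extendScalars K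
    convert this using 1
    ext t
    fin_cases t <;> rfl
  have heq : j Vz ^ 2 + j Vx * j Vy ^ 2 =
      algebraMap K L (algebraMap (CfDn n) K f) - j Vx ^ (2 ^ k * m) := by
    rw [← IsScalarTower.algebraMap_apply, ← j.commutes f, ← hkm,
      show algebraMap (CfDn n) Fxyz f = Vx ^ (n - 1) + Vx * Vy ^ 2 + Vz ^ 2 from rfl]
    simp only [map_add, map_mul, map_pow]
    ring
  have hgen : IntermediateField.adjoin K {j Vx, j Vy, j Vz} = ⊤ := by
    set E := IntermediateField.adjoin K {j Vx, j Vy, j Vz}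
    have hle : IntermediateField.adjoin ℂ {Vx, Vy, Vz} ≤
        { E.toSubfield.comap (j : Fxyz →+* L) with
          algebraMap_mem' := fun a => by
            change j (algebraMap (CfDn n) Fxyz (algebraMap ℂ (CfDn n) a)) ∈ E
            rw [j.commutes, IsScalarTower.algebraMap_apply (CfDn n) K L]
            exact E.algebraMap_mem _ } := by
      rw [IntermediateField.adjoin_le_iff]
      rintro w (rfl | rfl | rfl) <;> exact IntermediateField.subset_adjoin K _ (by simp)
    rw [adjoin_Vx_Vy_Vz] at hle
    have hE : Algebra.adjoin K (Set.range j) ≤ E.toSubalgebra := by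
      rw [Algebra.adjoin_le_iff]
      rintro _ ⟨w, rfl⟩
      exact hle (IntermediateField.mem_top (x := w))
    rw [hj] at hE
    exact eq_top_iff.2 fun w _ => hE (Algebra.mem_top (x := w))
  rw [hkm, padicValNat_two_mul_two_pow_mul hm]
  constructor
  · rintro ⟨g, h, hgh⟩
    obtain ⟨η, hη⟩ := hroot (2 * (2 ^ k * m)) (by have := hm.pos; positivity)
    exact exists_pow_eq_of_adjoin_pair_eq_top h2 hi hm (by omega) hη hxy heq hgh hgen
  · rintro ⟨ρ, hρ⟩
    obtain ⟨η, hη⟩ := hroot (2 * 2 ^ k) (by positivity)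
    exact exists_adjoin_pair_eq_top_of_pow_eq h2 hi hm hη hρ (hxy.transcendental 0) heq hgen

theorem dn_rational_iff_root (n : ℕ) (hn : 4 ≤ n) (K : Type) [Field K]
    [Algebra (CfDn n) K] [FiniteDimensional (CfDn n) K]
    (hL : IsField (K ⊗[CfDn n] Fxyz)) :
    letI : Field (K ⊗[CfDn n] Fxyz) := hL.toField
    ((∃ g h : K ⊗[CfDn n] Fxyz,
        Subfield.closure
          (Set.range (algebraMap K (K ⊗[CfDn n] Fxyz)) ∪ {g, h}) = ⊤) ↔
      ∃ ρ : K, ρ ^ (2 ^ (padicValNat 2 (2 * (n - 1)))) =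
        algebraMap (CfDn n) K
          ⟨fDn n, IntermediateField.subset_adjoin ℂ {fDn n} rfl⟩) := by
  let : Field (K ⊗[CfDn n] Fxyz) := hL.toField
  refine rational_iff_root_of_adjoin_range hn Algebra.TensorProduct.includeRight ?_
  rw [eq_top_iff]
  intro w _
  induction w using TensorProduct.induction_on with
  | zero => exact zero_mem _
  | add v w hv hw => exact add_mem (hv trivial) (hw trivial)
  | tmul a b =>
    have hb : (1 : K) ⊗ₜ[CfDn n] b ∈ Algebra.adjoin K (Set.range
        (Algebra.TensorProduct.includeRight : Fxyz →ₐ[CfDn n] K ⊗[CfDn n] Fxyz)) :=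
      Algebra.subset_adjoin ⟨b, rfl⟩
    rw [← mul_one a, ← smul_eq_mul, ← TensorProduct.smul_tmul']
    exact Subalgebra.smul_mem _ hb a

end
end

section
/- Every ℂ-algebra automorphism φ of A = ℂ[x,y,z]/(x⁴ + y³ + z²) is diagonal: there exist α, β, γ ∈ ℂ* with α⁴ = β³ = γ² such that φ(x) = αx, φ(y) = βy, φ(z) = γz, where x, y, z denote the images of the variables in A. In particular, every automorphism of the Klein surface {x⁴ + y³ + z² = 0} ⊂ ℂ³ extends to a diagonal linear automorphism of ℂ³. -/
open MvPolynomial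

noncomputable section

/-- The ideal (x⁴ + y³ + z²) in ℂ[x,y,z]. -/
def Ie6 : Ideal (MvPolynomial (Fin 3) ℂ) :=
  Ideal.span {(X 0 ^ 4 + X 1 ^ 3 + X 2 ^ 2 : MvPolynomial (Fin 3) ℂ)}

/-- The coordinate ring A = ℂ[x,y,z]/(x⁴ + y³ + z²) of the Klein surface. -/
abbrev Ae6 : Type := MvPolynomial (Fin 3) ℂ ⧸ Ie6

/-! ### Locally nilpotent derivations -/

namespace Derivation

variable {k R : Type*} [Field k] [CommRing R] [Algebra k R]

/-- The degree of `a` with respect to `D`: the largest `n` with `D^[n] a ≠ 0`, when `a ≠ 0` is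
killed by some iterate of `D`. -/
def nilDegree (D : Derivation k R R) (a : R) : ℕ := sInf {n | D^[n + 1] a = 0}

variable {D : Derivation k R R}

theorem iterate_zero_right (n : ℕ) : D^[n] 0 = 0 :=
  Function.iterate_fixed (map_zero D) n

theorem nilDegree_eq {a : R} {n : ℕ} (h : D^[n] a ≠ 0) (h' : D^[n + 1] a = 0) :
    D.nilDegree a = n := by
  refine le_antisymm (Nat.sInf_le h') (le_csInf ⟨n, h'⟩ fun m hm => ?_)
  by_contra! hlt
  apply h
  obtain ⟨j, rfl⟩ := Nat.exists_eq_add_of_le hlt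
  rw [Nat.succ_eq_add_one, add_comm, Function.iterate_add_apply, hm, iterate_zero_right]

theorem iterate_nilDegree (hD : ∀ a, ∃ n, D^[n] a = 0) {a : R} (ha : a ≠ 0) :
    D^[D.nilDegree a] a ≠ 0 ∧ D^[D.nilDegree a + 1] a = 0 := by
  classical
  have hpos : 0 < Nat.find (hD a) := by
    rw [Nat.find_pos]
    simpa using ha
  obtain ⟨n, hn⟩ := Nat.exists_eq_add_of_le' hpos
  have h' : D^[n + 1] a = 0 := by
    have := Nat.find_spec (hD a)
    rwa [hn] at this
  have h : D^[n] a ≠ 0 := Nat.find_min (hD a) (by omega)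
  rw [nilDegree_eq h h']
  exact ⟨h, h'⟩

theorem nilDegree_apply (hD : ∀ a, ∃ n, D^[n] a = 0) {a : R} (ha : D a ≠ 0) :
    D.nilDegree (D a) + 1 = D.nilDegree a := by
  obtain ⟨h, h'⟩ := iterate_nilDegree hD ha
  rw [← Function.iterate_succ_apply] at h h'
  exact (nilDegree_eq h h').symm

theorem nilDegree_eq_zero {a : R} (h : D a = 0) : D.nilDegree a = 0 :=
  Nat.le_zero.mp (Nat.sInf_le (by simpa using h))

theorem apply_eq_zero_of_nilDegree (hD : ∀ a, ∃ n, D^[n] a = 0) {a : R}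
    (h : D.nilDegree a = 0) : D a = 0 := by
  by_contra ha
  have := nilDegree_apply hD ha
  omega

theorem iterate_add_right (n : ℕ) (a b : R) : D^[n] (a + b) = D^[n] a + D^[n] b :=
  iterate_map_add D n a b

theorem iterate_mul_of_iterate_eq_zero (N : ℕ) : ∀ (m n : ℕ) (a b : R), m + n = N →
    D^[m + 1] a = 0 → D^[n + 1] b = 0 →
    D^[N] (a * b) = (N.choose m : R) * (D^[m] a * D^[n] b) := by
  induction N with
  | zero =>
    intro m n a b h
    obtain ⟨rfl, rfl⟩ : m = 0 ∧ n = 0 := by omega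
    simp
  | succ N ih =>
    intro m n a b h ha hb
    rw [Function.iterate_succ_apply, leibniz, smul_eq_mul, smul_eq_mul, iterate_add_right]
    rcases m with _ | m
    · obtain rfl : n = N + 1 := by omega
      have ha' : D a = 0 := by simpa using ha
      rw [ih 0 N a (D b) (by omega) ha (by rwa [← Function.iterate_succ_apply]), ha']
      simp
    · rcases n with _ | n
      · obtain rfl : m = N := by omega
        have hb' : D b = 0 := by simpa using hb
        rw [mul_comm b, ih m 0 (D a) b (by omega) (by rwa [← Function.iterate_succ_apply]) hb, hb']
        simp
      · rw [mul_comm b, ih (m + 1) n a (D b) (by omega) ha (by rwa [← Function.iterate_succ_apply]),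
          ih m (n + 1) (D a) b (by omega) (by rwa [← Function.iterate_succ_apply]) hb,
          Nat.choose_succ_succ]
        simp only [← Function.iterate_succ_apply]
        push_cast
        ring

variable [CharZero k] [IsDomain R]

theorem nilDegree_mul (hD : ∀ a, ∃ n, D^[n] a = 0) {a b : R} (ha : a ≠ 0) (hb : b ≠ 0) :
    D.nilDegree (a * b) = D.nilDegree a + D.nilDegree b := by
  have : CharZero R := charZero_of_injective_algebraMap (algebraMap k R).injective
  obtain ⟨h₁, h₂⟩ := iterate_nilDegree hD ha
  obtain ⟨h₃, h₄⟩ := iterate_nilDegree hD hb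
  have key := iterate_mul_of_iterate_eq_zero _ _ _ a b rfl h₂ h₄
  apply nilDegree_eq
  · rw [key]
    refine mul_ne_zero ?_ (mul_ne_zero h₁ h₃)
    exact_mod_cast (Nat.choose_pos (Nat.le_add_right _ _)).ne'
  · rw [Function.iterate_succ_apply', key, leibniz, leibniz, ← Function.iterate_succ_apply' D,
      ← Function.iterate_succ_apply' D, h₂, h₄]
    simp

/-- The kernel of a locally nilpotent derivation is factorially closed. -/
theorem apply_eq_zero_of_mul (hD : ∀ a, ∃ n, D^[n] a = 0) {a b : R} (hab : a * b ≠ 0)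
    (h : D (a * b) = 0) : D a = 0 := by
  have h₀ := nilDegree_eq_zero h
  rw [nilDegree_mul hD (left_ne_zero_of_mul hab) (right_ne_zero_of_mul hab)] at h₀
  exact apply_eq_zero_of_nilDegree hD (by omega)

end Derivation

/-! ### Rigidity of the relation `x⁴ + y³ + z² = 0` -/

section Rigidity

variable {R : Type*} [CommRing R] [Algebra ℂ R] {D : Derivation ℂ R R} {x y z : R}

theorem derivation_relation (h : x ^ 4 + y ^ 3 + z ^ 2 = 0) :
    4 * x ^ 3 * D x + 3 * y ^ 2 * D y + 2 * z * D z = 0 := by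
  have := congrArg D h
  simp only [map_add, Derivation.leibniz_pow, map_zero, smul_eq_mul, nsmul_eq_mul] at this
  push_cast at this
  linear_combination this

variable [IsDomain R]

theorem derivation_eq_zero_of_apply_y_eq_zero (hD : ∀ a, ∃ n, D^[n] a = 0)
    (h : x ^ 4 + y ^ 3 + z ^ 2 = 0) (hx : x ≠ 0) (hy : y ≠ 0) (hDy : D y = 0) :
    D x = 0 ∧ D z = 0 := by
  have : CharZero R := charZero_of_injective_algebraMap (algebraMap ℂ R).injective
  set i : R := algebraMap ℂ R Complex.I with hi
  have hi2 : i ^ 2 = -1 := by rw [hi, ← map_pow, Complex.I_sq, map_neg, map_one]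
  have hDi : D i = 0 := D.map_algebraMap _
  have hmul : (z + i * x ^ 2) * (z - i * x ^ 2) = -y ^ 3 := by
    linear_combination h - x ^ 4 * hi2
  have hne : (z + i * x ^ 2) * (z - i * x ^ 2) ≠ 0 := by
    rw [hmul]
    exact neg_ne_zero.mpr (pow_ne_zero _ hy)
  have hDmul : D ((z + i * x ^ 2) * (z - i * x ^ 2)) = 0 := by
    rw [hmul]
    simp [Derivation.leibniz_pow, hDy]
  have h₁ := Derivation.apply_eq_zero_of_mul hD hne hDmul
  rw [mul_comm] at hne hDmul
  have h₂ := Derivation.apply_eq_zero_of_mul hD hne hDmul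
  simp only [map_add, map_sub, Derivation.leibniz, Derivation.leibniz_pow, hDi, smul_eq_mul,
    nsmul_eq_mul] at h₁ h₂
  have hx' : x * D x = 0 := by
    have : 4 * i * (x * D x) = 0 := by
      push_cast at h₁ h₂
      linear_combination h₁ - h₂
    have hi0 : i ≠ 0 := by
      rintro h0
      rw [h0] at hi2
      norm_num at hi2
    exact (mul_eq_zero.mp this).resolve_left (mul_ne_zero (by norm_num) hi0)
  have hDz : 2 * D z = 0 := by linear_combination h₁ + h₂
  exact ⟨(mul_eq_zero.mp hx').resolve_left hx, (mul_eq_zero.mp hDz).resolve_left two_ne_zero⟩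

theorem derivation_eq_zero_of_apply_x_eq_zero (hD : ∀ a, ∃ n, D^[n] a = 0)
    (h : x ^ 4 + y ^ 3 + z ^ 2 = 0) (hx : x ≠ 0) (hy : y ≠ 0) (hz : z ≠ 0) (hDx : D x = 0) :
    D y = 0 ∧ D z = 0 := by
  have : CharZero R := charZero_of_injective_algebraMap (algebraMap ℂ R).injective
  have hrel := derivation_relation (D := D) h
  have hDy : D y = 0 := by
    by_contra hDy
    have hrel' : 3 * (y * y * D y) = - 2 * (z * D z) := by
      rw [hDx] at hrel
      linear_combination hrel
    have hDz : D z ≠ 0 := by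
      rintro h0
      rw [h0] at hrel'
      simp [hy, hDy] at hrel'
    have h3 : D 3 = 0 := by exact_mod_cast D.map_natCast 3
    have h2 : D (-2) = 0 := by exact_mod_cast D.map_intCast (-2)
    have hdeg := congrArg D.nilDegree hrel'
    rw [Derivation.nilDegree_mul hD (by norm_num : (3 : R) ≠ 0)
        (mul_ne_zero (mul_ne_zero hy hy) hDy),
      Derivation.nilDegree_mul hD (mul_ne_zero hy hy) hDy, Derivation.nilDegree_mul hD hy hy,
      Derivation.nilDegree_mul hD (by norm_num : (-2 : R) ≠ 0) (mul_ne_zero hz hDz),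
      Derivation.nilDegree_mul hD hz hDz, Derivation.nilDegree_eq_zero h3,
      Derivation.nilDegree_eq_zero h2] at hdeg
    have hdiv : 3 * x ^ 4 * D y = z * (2 * y * D z - 3 * z * D y) := by
      rw [hDx] at hrel
      linear_combination 3 * D y * h - y * hrel
    have hx4 : D (3 * x ^ 4) = 0 := by
      simp [Derivation.leibniz, Derivation.leibniz_pow, h3, hDx]
    have hne : 3 * x ^ 4 * D y ≠ 0 := by simp [hx, hDy]
    have hdeg' := congrArg D.nilDegree hdiv
    rw [Derivation.nilDegree_mul hD (left_ne_zero_of_mul hne) hDy,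
      Derivation.nilDegree_mul hD hz (right_ne_zero_of_mul (hdiv ▸ hne)),
      Derivation.nilDegree_eq_zero hx4] at hdeg'
    have := Derivation.nilDegree_apply hD hDy
    have := Derivation.nilDegree_apply hD hDz
    omega
  refine ⟨hDy, ?_⟩
  simpa [hDx, hDy, hz] using hrel

theorem derivation_eq_zero_of_apply_z_sub_eq_zero (hD : ∀ a, ∃ n, D^[n] a = 0)
    (h : x ^ 4 + y ^ 3 + z ^ 2 = 0) (hx : x ≠ 0) (hy : y ≠ 0) (c : ℂ)
    (hw : z - algebraMap ℂ R c * x ^ 2 ≠ 0) (hr : x ^ 2 + algebraMap ℂ R c * z ≠ 0)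
    (hDw : D (z - algebraMap ℂ R c * x ^ 2) = 0) :
    D x = 0 ∧ D y = 0 ∧ D z = 0 := by
  have : CharZero R := charZero_of_injective_algebraMap (algebraMap ℂ R).injective
  set e : R := algebraMap ℂ R c with he
  have hDe : D e = 0 := D.map_algebraMap _
  have hDz : D z = 2 * e * x * D x := by
    simp only [map_sub, Derivation.leibniz, Derivation.leibniz_pow, hDe, smul_eq_mul,
      nsmul_eq_mul] at hDw
    push_cast at hDw
    linear_combination hDw
  have hrel := derivation_relation (D := D) h
  rw [hDz] at hrel
  have hDx : D x = 0 := by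
    by_contra hDx
    have hrel' : 4 * (x * (x ^ 2 + e * z) * D x) = - 3 * (y * y * D y) := by
      linear_combination hrel
    have hDy : D y ≠ 0 := by
      rintro h0
      rw [h0] at hrel'
      simp [hx, hr, hDx] at hrel'
    have h4 : D 4 = 0 := by exact_mod_cast D.map_natCast 4
    have h3 : D (-3) = 0 := by exact_mod_cast D.map_intCast (-3)
    have hdeg := congrArg D.nilDegree hrel'
    rw [Derivation.nilDegree_mul hD (by norm_num : (4 : R) ≠ 0)
        (mul_ne_zero (mul_ne_zero hx hr) hDx),
      Derivation.nilDegree_mul hD (mul_ne_zero hx hr) hDx, Derivation.nilDegree_mul hD hx hr,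
      Derivation.nilDegree_mul hD (by norm_num : (-3 : R) ≠ 0)
        (mul_ne_zero (mul_ne_zero hy hy) hDy),
      Derivation.nilDegree_mul hD (mul_ne_zero hy hy) hDy, Derivation.nilDegree_mul hD hy hy,
      Derivation.nilDegree_eq_zero h4, Derivation.nilDegree_eq_zero h3] at hdeg
    set w := z - e * x ^ 2 with hwdef
    have hdiv : 4 * w ^ 3 * D x = y * y * ((1 + e ^ 2) * w * (-4 * y * D x + 3 * x * D y) -
        e * (-4 * y * (x ^ 2 + e * z) * D x +
          3 * x * ((1 + e ^ 2) * x ^ 2 + 2 * e * w) * D y)) := by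
      rw [hwdef]
      linear_combination (1 + e ^ 2) * (z - e * x ^ 2) * (4 * D x * h - x * hrel) -
        e * (4 * (x ^ 2 + e * z) * D x * h -
          x * ((1 + e ^ 2) * x ^ 2 + 2 * e * (z - e * x ^ 2)) * hrel)
    have hw3 : D (4 * w ^ 3) = 0 := by
      simp [Derivation.leibniz, Derivation.leibniz_pow, h4, hDw]
    have hne : 4 * w ^ 3 * D x ≠ 0 := by simp [hw, hDx]
    have hdeg' := congrArg D.nilDegree hdiv
    rw [Derivation.nilDegree_mul hD (left_ne_zero_of_mul hne) hDx,
      Derivation.nilDegree_mul hD (mul_ne_zero hy hy) (right_ne_zero_of_mul (hdiv ▸ hne)),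
      Derivation.nilDegree_mul hD hy hy, Derivation.nilDegree_eq_zero hw3] at hdeg'
    have := Derivation.nilDegree_apply hD hDx
    have := Derivation.nilDegree_apply hD hDy
    omega
  rw [hDx] at hDz hrel
  refine ⟨hDx, ?_, by simpa using hDz⟩
  simpa [hy] using hrel

end Rigidity

/-! ### Derivations of graded algebras -/

namespace GradedAlgebra

variable {k R : Type*} [Field k] [CommRing R] [Algebra k R]
variable (𝒜 : ℕ → Submodule k R) [GradedAlgebra 𝒜]

/-- The elements all of whose homogeneous components have degree at most `m`. -/
def degreeLE (m : ℕ) : Submodule k R :=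
  ⨅ i : {i // m < i}, LinearMap.ker (proj 𝒜 i)

variable {𝒜}

theorem mem_degreeLE {m : ℕ} {a : R} : a ∈ degreeLE 𝒜 m ↔ ∀ i, m < i → proj 𝒜 i a = 0 := by
  simp [degreeLE]

theorem proj_of_mem {n : ℕ} {a : R} (ha : a ∈ 𝒜 n) : proj 𝒜 n a = a :=
  DirectSum.decompose_of_mem_same 𝒜 ha

theorem proj_of_mem_ne {m n : ℕ} {a : R} (ha : a ∈ 𝒜 n) (h : n ≠ m) : proj 𝒜 m a = 0 :=
  DirectSum.decompose_of_mem_ne 𝒜 ha h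

theorem proj_mem (n : ℕ) (a : R) : proj 𝒜 n a ∈ 𝒜 n :=
  SetLike.coe_mem _

theorem mem_degreeLE_of_mem {m n : ℕ} {a : R} (ha : a ∈ 𝒜 n) (h : n ≤ m) :
    a ∈ degreeLE 𝒜 m :=
  mem_degreeLE.mpr fun _ hi => proj_of_mem_ne ha (by omega)

theorem degreeLE_mono {m n : ℕ} (h : m ≤ n) : degreeLE 𝒜 m ≤ degreeLE 𝒜 n :=
  fun _ ha => mem_degreeLE.mpr fun i hi => mem_degreeLE.mp ha i (by omega)

theorem proj_mul_add {m n : ℕ} {a : R} (b : R) (ha : a ∈ 𝒜 m) :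
    proj 𝒜 (m + n) (a * b) = a * proj 𝒜 n b :=
  DirectSum.coe_decompose_mul_add_of_left_mem 𝒜 ha

theorem mul_mem_degreeLE {m n : ℕ} {a b : R} (ha : a ∈ 𝒜 m) (hb : b ∈ degreeLE 𝒜 n) :
    a * b ∈ degreeLE 𝒜 (m + n) := by
  refine mem_degreeLE.mpr fun i hi => ?_
  obtain ⟨j, rfl⟩ := Nat.exists_eq_add_of_le (show m ≤ i by omega)
  rw [proj_mul_add b ha, mem_degreeLE.mp hb j (by omega), mul_zero]

theorem exists_mem_degreeLE (a : R) : ∃ m, a ∈ degreeLE 𝒜 m := by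
  induction a using DirectSum.Decomposition.inductionOn 𝒜 with
  | zero => exact ⟨0, zero_mem _⟩
  | homogeneous a => exact ⟨_, mem_degreeLE_of_mem a.2 le_rfl⟩
  | add a b ha hb =>
    obtain ⟨m, hm⟩ := ha
    obtain ⟨n, hn⟩ := hb
    exact ⟨max m n, add_mem (degreeLE_mono (le_max_left _ _) hm)
      (degreeLE_mono (le_max_right _ _) hn)⟩

theorem eq_sum_proj {m : ℕ} {a : R} (ha : a ∈ degreeLE 𝒜 m) :
    a = ∑ i ∈ Finset.range (m + 1), proj 𝒜 i a := by
  classical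
  conv_lhs => rw [← DirectSum.sum_support_decompose 𝒜 a]
  refine Finset.sum_subset (fun i hi => ?_) fun i _ hi => ?_
  · by_contra hlt
    have := mem_degreeLE.mp ha i (by simpa using hlt)
    simp [proj_apply] at this
    simp [this] at hi
  · simpa using hi

/-- The linear map given on each homogeneous part by `f`. -/
def linearMapOfHomogeneous (f : ∀ n, 𝒜 n →ₗ[k] R) : R →ₗ[k] R :=
  DirectSum.toModule k ℕ R f ∘ₗ (DirectSum.decomposeLinearEquiv 𝒜).toLinearMap

theorem linearMapOfHomogeneous_apply (f : ∀ n, 𝒜 n →ₗ[k] R) {n : ℕ} {a : R} (ha : a ∈ 𝒜 n) :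
    linearMapOfHomogeneous f a = f n ⟨a, ha⟩ := by
  lift a to 𝒜 n using ha
  simp [linearMapOfHomogeneous]

/-- A linear map that satisfies the Leibniz rule on homogeneous elements is a derivation. -/
def derivationOfHomogeneous (L : R →ₗ[k] R)
    (hL : ∀ m n a b, a ∈ 𝒜 m → b ∈ 𝒜 n → L (a * b) = a * L b + b * L a) : Derivation k R R :=
  Derivation.mk' L fun a b => by
    induction a using DirectSum.Decomposition.inductionOn 𝒜 with
    | zero => simp
    | add a a' ha ha' =>
      simp only [add_mul, map_add, ha, ha', smul_eq_mul]
      ring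
    | homogeneous a =>
      induction b using DirectSum.Decomposition.inductionOn 𝒜 with
      | zero => simp
      | add b b' hb hb' =>
        simp only [mul_add, map_add, hb, hb', smul_eq_mul]
        ring
      | homogeneous b => exact hL _ _ _ _ a.2 b.2

variable (𝒜) in
/-- The Euler derivation, which multiplies the homogeneous elements of degree `n` by `n`. -/
def euler : Derivation k R R :=
  derivationOfHomogeneous (𝒜 := 𝒜) (linearMapOfHomogeneous fun n => (n : k) • (𝒜 n).subtype)
    fun m n a b ha hb => by
      rw [linearMapOfHomogeneous_apply _ ha, linearMapOfHomogeneous_apply _ hb,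
        linearMapOfHomogeneous_apply _ (SetLike.mul_mem_graded ha hb)]
      simp only [LinearMap.smul_apply, Submodule.subtype_apply, Algebra.smul_def]
      push_cast
      ring

theorem euler_apply {n : ℕ} {a : R} (ha : a ∈ 𝒜 n) : euler 𝒜 a = (n : k) • a :=
  linearMapOfHomogeneous_apply _ ha

theorem proj_euler (n : ℕ) (a : R) : proj 𝒜 n (euler 𝒜 a) = (n : k) • proj 𝒜 n a := by
  induction a using DirectSum.Decomposition.inductionOn 𝒜 with
  | zero => simp
  | add a b ha hb => rw [map_add, map_add, map_add, ha, hb, smul_add]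
  | @homogeneous i a =>
    rw [euler_apply a.2, map_smul]
    rcases eq_or_ne i n with rfl | h
    · rfl
    · simp [proj_of_mem_ne a.2 h]

/-- Eigenvectors of the Euler derivation are homogeneous. -/
theorem exists_mem_of_euler_eq_smul [CharZero k] {a : R} {c : k} (ha : a ≠ 0)
    (h : euler 𝒜 a = c • a) : ∃ n : ℕ, c = n ∧ a ∈ 𝒜 n := by
  have key : ∀ n, proj 𝒜 n a ≠ 0 → c = n := fun n hn => by
    have := congrArg (proj 𝒜 n) h
    rw [proj_euler, map_smul, ← sub_eq_zero, ← sub_smul, smul_eq_zero, sub_eq_zero] at this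
    exact (this.resolve_right hn).symm
  obtain ⟨m, hm⟩ := exists_mem_degreeLE (𝒜 := 𝒜) a
  have hsum := eq_sum_proj hm
  obtain ⟨n, hn, hne⟩ := Finset.exists_ne_zero_of_sum_ne_zero (hsum ▸ ha)
  refine ⟨n, key n hne, ?_⟩
  rw [hsum, Finset.sum_eq_single_of_mem n hn fun i _ hi => ?_]
  · exact proj_mem n a
  · by_contra hi'
    exact hi (Nat.cast_injective ((key i hi').symm.trans (key n hne)))

variable (𝒜) in
/-- The component of degree `j` of a derivation. -/
def component (D : Derivation k R R) (j : ℕ) : Derivation k R R :=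
  derivationOfHomogeneous (𝒜 := 𝒜)
    (linearMapOfHomogeneous fun n => proj 𝒜 (n + j) ∘ₗ D.toLinearMap ∘ₗ (𝒜 n).subtype)
    fun m n a b ha hb => by
      rw [linearMapOfHomogeneous_apply _ ha, linearMapOfHomogeneous_apply _ hb,
        linearMapOfHomogeneous_apply _ (SetLike.mul_mem_graded ha hb)]
      simp only [LinearMap.comp_apply, Submodule.subtype_apply, Derivation.coeFn_coe,
        Derivation.leibniz, smul_eq_mul, map_add]
      rw [add_assoc m n j, proj_mul_add _ ha, add_left_comm m n j, proj_mul_add _ hb]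

theorem component_apply (D : Derivation k R R) (j : ℕ) {n : ℕ} {a : R} (ha : a ∈ 𝒜 n) :
    component 𝒜 D j a = proj 𝒜 (n + j) (D a) :=
  linearMapOfHomogeneous_apply _ ha

theorem component_mem (D : Derivation k R R) (j : ℕ) {n : ℕ} {a : R} (ha : a ∈ 𝒜 n) :
    component 𝒜 D j a ∈ 𝒜 (n + j) := by
  rw [component_apply D j ha]
  exact proj_mem _ _

theorem iterate_component_mem (D : Derivation k R R) (j : ℕ) {n : ℕ} {a : R} (ha : a ∈ 𝒜 n)
    (i : ℕ) : (component 𝒜 D j)^[i] a ∈ 𝒜 (n + i * j) := by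
  induction i with
  | zero => simpa using ha
  | succ i ih =>
    rw [Function.iterate_succ_apply', add_mul, one_mul, ← add_assoc]
    exact component_mem D j ih

section Bounded

variable {D : Derivation k R R} {j : ℕ}

theorem apply_mem_degreeLE (hD : ∀ n, ∀ a ∈ 𝒜 n, D a ∈ degreeLE 𝒜 (n + j)) {m : ℕ} {a : R}
    (ha : a ∈ degreeLE 𝒜 m) : D a ∈ degreeLE 𝒜 (m + j) := by
  rw [eq_sum_proj ha, map_sum]
  refine sum_mem fun i hi => degreeLE_mono ?_ (hD i _ (proj_mem i a))
  have := Finset.mem_range.mp hi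
  omega

theorem proj_apply_of_mem_degreeLE (hD : ∀ n, ∀ a ∈ 𝒜 n, D a ∈ degreeLE 𝒜 (n + j)) {m : ℕ}
    {a : R} (ha : a ∈ degreeLE 𝒜 m) :
    proj 𝒜 (m + j) (D a) = component 𝒜 D j (proj 𝒜 m a) := by
  rw [component_apply D j (proj_mem m a)]
  conv_lhs => rw [eq_sum_proj ha, map_sum, map_sum]
  refine Finset.sum_eq_single_of_mem m (by simp) fun i hi him => ?_
  have := Finset.mem_range.mp hi
  exact mem_degreeLE.mp (hD i _ (proj_mem i a)) _ (by omega)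

theorem iterate_component_apply (hD : ∀ n, ∀ a ∈ 𝒜 n, D a ∈ degreeLE 𝒜 (n + j)) {n : ℕ}
    {a : R} (ha : a ∈ 𝒜 n) (i : ℕ) :
    D^[i] a ∈ degreeLE 𝒜 (n + i * j) ∧
      (component 𝒜 D j)^[i] a = proj 𝒜 (n + i * j) (D^[i] a) := by
  induction i with
  | zero => simpa [proj_of_mem ha] using mem_degreeLE_of_mem ha le_rfl
  | succ i ih =>
    rw [Function.iterate_succ_apply', Function.iterate_succ_apply', add_mul, one_mul, ← add_assoc,
      ih.2, proj_apply_of_mem_degreeLE hD ih.1]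
    exact ⟨apply_mem_degreeLE hD ih.1, rfl⟩

/-- The top component of a derivation of positive degree with bounded orbits is locally
nilpotent. -/
theorem exists_iterate_component_eq_zero (hj : 0 < j)
    (hD : ∀ n, ∀ a ∈ 𝒜 n, D a ∈ degreeLE 𝒜 (n + j))
    (hfin : ∀ a, ∃ M, ∀ i, D^[i] a ∈ degreeLE 𝒜 M) (a : R) :
    ∃ i, (component 𝒜 D j)^[i] a = 0 := by
  induction a using DirectSum.Decomposition.inductionOn 𝒜 with
  | zero => exact ⟨0, rfl⟩
  | add a b ha hb =>
    obtain ⟨m, hm⟩ := ha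
    obtain ⟨n, hn⟩ := hb
    refine ⟨m + n, ?_⟩
    rw [iterate_map_add, Function.iterate_add_apply _ m n b, hn, add_comm m n,
      Function.iterate_add_apply _ n m a, hm]
    simp
  | @homogeneous n a =>
    obtain ⟨M, hM⟩ := hfin a
    refine ⟨M + 1, ?_⟩
    rw [(iterate_component_apply hD a.2 _).2]
    refine mem_degreeLE.mp (hM _) _ ?_
    nlinarith

end Bounded

theorem exists_forall_iterate_conj_mem_degreeLE (φ : R ≃ₐ[k] R) (a : R) :
    ∃ M, ∀ i, φ ((euler 𝒜)^[i] a) ∈ degreeLE 𝒜 M := by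
  induction a using DirectSum.Decomposition.inductionOn 𝒜 with
  | zero => exact ⟨0, fun i => by simp⟩
  | add a b ha hb =>
    obtain ⟨m, hm⟩ := ha
    obtain ⟨n, hn⟩ := hb
    refine ⟨max m n, fun i => ?_⟩
    rw [iterate_map_add, map_add]
    exact add_mem (degreeLE_mono (le_max_left _ _) (hm i))
      (degreeLE_mono (le_max_right _ _) (hn i))
  | @homogeneous n a =>
    obtain ⟨M, hM⟩ := exists_mem_degreeLE (𝒜 := 𝒜) (φ a)
    refine ⟨M, fun i => ?_⟩
    have : (euler 𝒜)^[i] (a : R) = (n : k) ^ i • (a : R) := by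
      induction i with
      | zero => simp
      | succ i ih =>
        rw [Function.iterate_succ_apply', ih, Derivation.map_smul, euler_apply a.2, smul_smul,
          pow_succ]
    rw [this, map_smul]
    exact Submodule.smul_mem _ _ hM

end GradedAlgebra

/-- The conjugate of a derivation by an automorphism. -/
def Derivation.conj {k R : Type*} [Field k] [CommRing R] [Algebra k R] (φ : R ≃ₐ[k] R)
    (D : Derivation k R R) : Derivation k R R :=
  Derivation.mk' (φ.toLinearMap ∘ₗ D.toLinearMap ∘ₗ φ.symm.toLinearMap) fun a b => by
    simp [Derivation.leibniz]

theorem Derivation.conj_apply {k R : Type*} [Field k] [CommRing R] [Algebra k R] (φ : R ≃ₐ[k] R)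
    (D : Derivation k R R) (a : R) : D.conj φ (φ a) = φ (D a) :=
  congrArg (fun b => φ (D b)) (φ.symm_apply_apply a)

theorem Derivation.iterate_conj_apply {k R : Type*} [Field k] [CommRing R] [Algebra k R]
    (φ : R ≃ₐ[k] R) (D : Derivation k R R) (a : R) (i : ℕ) :
    (D.conj φ)^[i] (φ a) = φ (D^[i] a) :=
  (Function.Semiconj.iterate_right (fun b => (D.conj_apply φ b).symm) i a).symm

/-! ### The coordinate ring as a domain -/

/-- The image in `Ae6` of the `i`-th variable. -/
def e6Gen (i : Fin 3) : Ae6 := Ideal.Quotient.mk Ie6 (X i)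

namespace E6

local notation "x" => e6Gen 0
local notation "y" => e6Gen 1
local notation "z" => e6Gen 2

theorem relation : x ^ 4 + y ^ 3 + z ^ 2 = 0 := by
  simp only [e6Gen, ← map_pow, ← map_add]
  exact Ideal.Quotient.eq_zero_iff_mem.mpr (Ideal.subset_span rfl)

/-- The algebra map out of `Ae6` given by a solution of the defining equation. -/
def lift {S : Type*} [CommRing S] [Algebra ℂ S] (a b c : S) (h : a ^ 4 + b ^ 3 + c ^ 2 = 0) :
    Ae6 →ₐ[ℂ] S :=
  Ideal.Quotient.liftₐ Ie6 (aeval ![a, b, c]) fun p hp => by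
    have : Ie6 ≤ RingHom.ker (aeval (R := ℂ) ![a, b, c]) := by
      rw [Ie6, Ideal.span_le, Set.singleton_subset_iff, SetLike.mem_coe, RingHom.mem_ker]
      simpa using h
    exact this hp

section lift

variable {S : Type*} [CommRing S] [Algebra ℂ S] {a b c : S} (h : a ^ 4 + b ^ 3 + c ^ 2 = 0)

@[simp]
theorem lift_x : lift a b c h x = a :=
  (aeval_X _ _).trans rfl

@[simp]
theorem lift_y : lift a b c h y = b :=
  (aeval_X _ _).trans rfl

@[simp]
theorem lift_z : lift a b c h z = c :=
  (aeval_X _ _).trans rfl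

end lift

theorem algHom_ext {S : Type*} [CommRing S] [Algebra ℂ S] {f g : Ae6 →ₐ[ℂ] S}
    (hx : f x = g x) (hy : f y = g y) (hz : f z = g z) : f = g := by
  refine Ideal.Quotient.algHom_ext _ (MvPolynomial.algHom_ext fun i => ?_)
  fin_cases i
  exacts [hx, hy, hz]

open scoped Polynomial in
/-- The polynomial `y³ + (x⁴ + z²)` in `y` with coefficients in `ℂ[x][z]`. -/
def cubic : ℂ[X][X][X] :=
  Polynomial.X ^ 3 + Polynomial.C (Polynomial.X ^ 2 + Polynomial.C (Polynomial.X ^ 4))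

section cubic

open scoped Polynomial

theorem cubic_monic : cubic.Monic := by
  unfold cubic
  monicity!

theorem cubic_natDegree : cubic.natDegree = 3 := by
  unfold cubic
  compute_degree!

theorem cubic_irreducible : Irreducible cubic := by
  rw [cubic_monic.irreducible_iff_roots_eq_zero_of_degree_le_three
    (by rw [cubic_natDegree]; norm_num) (by rw [cubic_natDegree])]
  refine Multiset.eq_zero_of_forall_notMem fun r hr => ?_
  have hroot : r ^ 3 + (Polynomial.X ^ 2 + Polynomial.C (Polynomial.X ^ 4)) = 0 := by
    simpa [cubic, Polynomial.IsRoot.def] using (Polynomial.mem_roots'.mp hr).2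
  have hdeg : (r ^ 3).natDegree = 2 := by
    rw [eq_neg_of_add_eq_zero_left hroot, Polynomial.natDegree_neg]
    compute_degree!
  rw [Polynomial.natDegree_pow] at hdeg
  omega

instance : IsDomain (AdjoinRoot cubic) :=
  AdjoinRoot.isDomain_of_prime cubic_irreducible.prime

theorem root_relation : AdjoinRoot.of cubic (Polynomial.C Polynomial.X) ^ 4 +
    AdjoinRoot.root cubic ^ 3 + AdjoinRoot.of cubic Polynomial.X ^ 2 = 0 := by
  have : AdjoinRoot.mk cubic (Polynomial.X ^ 3 +
      Polynomial.C (Polynomial.X ^ 2 + Polynomial.C (Polynomial.X ^ 4))) = 0 :=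
    AdjoinRoot.mk_self
  simp only [map_add, map_pow, AdjoinRoot.mk_X, AdjoinRoot.mk_C] at this
  linear_combination this

/-- The comparison map from `Ae6` to the extension of `ℂ[x][z]` by a root of `cubic`. -/
def toAdjoinRoot : Ae6 →ₐ[ℂ] AdjoinRoot cubic :=
  lift (AdjoinRoot.of cubic (Polynomial.C Polynomial.X)) (AdjoinRoot.root cubic)
    (AdjoinRoot.of cubic Polynomial.X) root_relation

/-- Evaluation of a polynomial in `ℂ[x][z]` in `Ae6`. -/
def evalXZ : ℂ[X][X] →+* Ae6 := Polynomial.eval₂RingHom (Polynomial.aeval x).toRingHom z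

/-- The inverse of `toAdjoinRoot`. -/
def ofAdjoinRoot : AdjoinRoot cubic →+* Ae6 :=
  AdjoinRoot.lift evalXZ y (by
    simp [cubic, evalXZ, -map_pow, -map_add]
    rw [map_pow, Polynomial.aeval_X]
    linear_combination relation)

theorem toAdjoinRoot_injective : Function.Injective toAdjoinRoot := by
  have hleft : ∀ a, ofAdjoinRoot (toAdjoinRoot a) = a := by
    have halg : ∀ c : ℂ, ofAdjoinRoot (algebraMap ℂ _ c) = algebraMap ℂ _ c := fun c => by
      rw [show algebraMap ℂ (AdjoinRoot cubic) c =
        AdjoinRoot.of cubic (Polynomial.C (Polynomial.C c)) from rfl]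
      simp [ofAdjoinRoot, evalXZ]
    let f : AdjoinRoot cubic →ₐ[ℂ] Ae6 := { ofAdjoinRoot with commutes' := halg }
    have : f.comp toAdjoinRoot = AlgHom.id ℂ Ae6 := by
      apply algHom_ext <;>
        simp [f, toAdjoinRoot, ofAdjoinRoot, evalXZ]
    exact fun a => DFunLike.congr_fun this a
  exact Function.LeftInverse.injective hleft

instance : IsDomain Ae6 := toAdjoinRoot_injective.isDomain toAdjoinRoot.toRingHom

theorem coeff_eq_zero {p₀ p₁ p₂ : ℂ[X][X]}
    (h : AdjoinRoot.mk cubic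
      (Polynomial.C p₀ + Polynomial.C p₁ * Polynomial.X + Polynomial.C p₂ * Polynomial.X ^ 2) = 0) :
    p₀ = 0 ∧ p₁ = 0 ∧ p₂ = 0 := by
  have hzero : Polynomial.C p₀ + Polynomial.C p₁ * Polynomial.X +
      Polynomial.C p₂ * Polynomial.X ^ 2 = 0 := by
    by_contra hne
    refine cubic_monic.not_dvd_of_natDegree_lt hne ?_ (AdjoinRoot.mk_eq_zero.mp h)
    rw [cubic_natDegree]
    refine lt_of_le_of_lt (b := 2) ?_ (by norm_num)
    compute_degree!
  refine ⟨?_, ?_, ?_⟩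
  · simpa using congrArg (fun p => p.coeff 0) hzero
  · simpa [Polynomial.coeff_X, Polynomial.coeff_C] using congrArg (fun p => p.coeff 1) hzero
  · simpa [Polynomial.coeff_X, Polynomial.coeff_C] using congrArg (fun p => p.coeff 2) hzero

/-- Linear independence of monomials of weighted degree at most `12` that do not involve `y³`. -/
theorem monomials_independent {a₃ a₄ b₀ b₁ c₀ c₁ c₂ d e : ℂ}
    (h : a₃ • x ^ 3 + a₄ • x ^ 4 + b₀ • y ^ 2 + b₁ • (x * y ^ 2) + c₀ • z + c₁ • (x * z) +
      c₂ • (x ^ 2 * z) + d • (y * z) + e • z ^ 2 = 0) :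
    a₃ = 0 ∧ a₄ = 0 ∧ b₀ = 0 ∧ b₁ = 0 ∧ c₀ = 0 ∧ c₁ = 0 ∧ c₂ = 0 ∧ d = 0 ∧ e = 0 := by
  have halg : ∀ c : ℂ, algebraMap ℂ (AdjoinRoot cubic) c =
      AdjoinRoot.of cubic (Polynomial.C (Polynomial.C c)) :=
    fun c => rfl
  have h' := congrArg toAdjoinRoot h
  obtain ⟨h₀, h₁, h₂⟩ := coeff_eq_zero
    (p₀ := Polynomial.C (Polynomial.C a₃ * Polynomial.X ^ 3 + Polynomial.C a₄ * Polynomial.X ^ 4) +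
      Polynomial.C (Polynomial.C c₀ + Polynomial.C c₁ * Polynomial.X +
        Polynomial.C c₂ * Polynomial.X ^ 2) * Polynomial.X +
      Polynomial.C (Polynomial.C e) * Polynomial.X ^ 2)
    (p₁ := Polynomial.C (Polynomial.C d) * Polynomial.X)
    (p₂ := Polynomial.C (Polynomial.C b₀ + Polynomial.C b₁ * Polynomial.X)) (by
    simp only [toAdjoinRoot, map_add, map_smul, map_mul, map_pow, map_zero, lift_x, lift_y, lift_z,
      Algebra.smul_def, halg] at h'
    simp only [map_add, map_mul, map_pow, AdjoinRoot.mk_X, AdjoinRoot.mk_C]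
    linear_combination h')
  have co := fun (p : ℂ[X][X]) (i j : ℕ) (hp : p = 0) =>
    show (p.coeff i).coeff j = 0 by rw [hp]; simp
  refine ⟨?_, ?_, ?_, ?_, ?_, ?_, ?_, ?_, ?_⟩
  · simpa [Polynomial.coeff_X, Polynomial.coeff_C, Polynomial.coeff_X_pow, -map_pow]
      using co _ 0 3 h₀
  · simpa [Polynomial.coeff_X, Polynomial.coeff_C, Polynomial.coeff_X_pow, -map_pow]
      using co _ 0 4 h₀
  · simpa [Polynomial.coeff_X, Polynomial.coeff_C, Polynomial.coeff_X_pow, -map_pow]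
      using co _ 0 0 h₂
  · simpa [Polynomial.coeff_X, Polynomial.coeff_C, Polynomial.coeff_X_pow, -map_pow]
      using co _ 0 1 h₂
  · simpa [Polynomial.coeff_X, Polynomial.coeff_C, Polynomial.coeff_X_pow, -map_pow]
      using co _ 1 0 h₀
  · simpa [Polynomial.coeff_X, Polynomial.coeff_C, Polynomial.coeff_X_pow, -map_pow]
      using co _ 1 1 h₀
  · simpa [Polynomial.coeff_X, Polynomial.coeff_C, Polynomial.coeff_X_pow, -map_pow]
      using co _ 1 2 h₀
  · simpa [Polynomial.coeff_X, Polynomial.coeff_C, Polynomial.coeff_X_pow, -map_pow]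
      using co _ 1 0 h₁
  · simpa [Polynomial.coeff_X, Polynomial.coeff_C, Polynomial.coeff_X_pow, -map_pow]
      using co _ 2 0 h₀

end cubic

theorem smul_eq (c : ℂ) (a : Ae6) : c • a = algebraMap ℂ Ae6 c * a :=
  Algebra.smul_def c a

theorem x_sq_add_ne_zero (c : ℂ) : x ^ 2 + algebraMap ℂ Ae6 c * z ≠ 0 := fun h => by
  have := monomials_independent (a₃ := 0) (a₄ := 1) (b₀ := 0) (b₁ := 0) (c₀ := 0) (c₁ := 0)
    (c₂ := c) (d := 0) (e := 0) (by
      simp only [smul_eq, map_zero, map_one]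
      linear_combination x ^ 2 * h)
  simpa using this.2.1

theorem z_sub_ne_zero (c : ℂ) : z - algebraMap ℂ Ae6 c * x ^ 2 ≠ 0 := fun h => by
  have := monomials_independent (a₃ := 0) (a₄ := -c) (b₀ := 0) (b₁ := 0) (c₀ := 0) (c₁ := 0)
    (c₂ := 1) (d := 0) (e := 0) (by
      simp only [smul_eq, map_zero, map_one, map_neg]
      linear_combination x ^ 2 * h)
  simpa using this.2.2.2.2.2.2.1

theorem x_ne_zero : x ≠ 0 := fun h => x_sq_add_ne_zero 0 (by simp [h])

theorem z_ne_zero : z ≠ 0 := fun h => z_sub_ne_zero 0 (by simp [h])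

theorem y_ne_zero : y ≠ 0 := fun h => by
  have := monomials_independent (a₃ := 0) (a₄ := 0) (b₀ := 1) (b₁ := 0) (c₀ := 0) (c₁ := 0)
    (c₂ := 0) (d := 0) (e := 0) (by simp [h])
  simpa using this.2.2.1

end E6

/-! ### The weighted grading of the coordinate ring -/

/-- A binary form of positive degree over `ℂ` has a linear factor. -/
theorem MvPolynomial.IsHomogeneous.exists_linear_factor {m : ℕ} {q : MvPolynomial (Fin 2) ℂ}
    (hq : q.IsHomogeneous (m + 1)) : X 1 ∣ q ∨ ∃ c, X 0 - C c * X 1 ∣ q := by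
  set p : Polynomial ℂ := MvPolynomial.aeval ![Polynomial.X, 1] q
  have hdeg : p.natDegree ≤ (m + 1) * 1 :=
    MvPolynomial.aeval_natDegree_le _ hq.totalDegree_le _ fun i => by fin_cases i <;> simp
  rw [mul_one, add_comm] at hdeg
  have hpq : p.homogenize (1 + m) = q := by
    rw [add_comm]
    exact Polynomial.homogenize_eq_of_isHomogeneous hq rfl
  rcases Nat.lt_or_ge m p.natDegree with hlt | hle
  · right
    obtain ⟨c, hc⟩ := IsAlgClosed.exists_root p
      (Polynomial.degree_ne_of_natDegree_ne (n := 0) (by omega))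
    obtain ⟨r, hr⟩ := Polynomial.dvd_iff_isRoot.mpr hc
    have hr0 : r ≠ 0 := by
      rintro rfl
      simp [hr] at hlt
    have hrdeg : r.natDegree ≤ m := by
      rw [hr, (Polynomial.monic_X_sub_C c).natDegree_mul' hr0, Polynomial.natDegree_X_sub_C] at hdeg
      omega
    refine ⟨c, r.homogenize m, ?_⟩
    rw [← hpq, hr, Polynomial.homogenize_mul _ _ (Polynomial.natDegree_X_sub_C c).le hrdeg]
    simp
  · left
    refine ⟨p.homogenize m, ?_⟩
    conv_lhs => rw [← hpq, ← one_mul p]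
    rw [Polynomial.homogenize_mul _ _ (by simp) hle]
    simp

namespace E6

local notation "x" => e6Gen 0
local notation "y" => e6Gen 1
local notation "z" => e6Gen 2

/-- The homogeneous parts of `Ae6` when `x`, `y`, `z` have the weights `3`, `4`, `6`. -/
def grading (n : ℕ) : Submodule ℂ Ae6 :=
  Submodule.span ℂ {m | ∃ a b c, 3 * a + 4 * b + 6 * c = n ∧ m = x ^ a * y ^ b * z ^ c}

theorem monomial_mem_grading {a b c n : ℕ} (h : 3 * a + 4 * b + 6 * c = n) :
    x ^ a * y ^ b * z ^ c ∈ grading n :=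
  Submodule.subset_span ⟨a, b, c, h, rfl⟩

theorem x_mem : x ∈ grading 3 := by
  simpa using monomial_mem_grading (a := 1) (b := 0) (c := 0) rfl

theorem y_mem : y ∈ grading 4 := by
  simpa using monomial_mem_grading (a := 0) (b := 1) (c := 0) rfl

theorem z_mem : z ∈ grading 6 := by
  simpa using monomial_mem_grading (a := 0) (b := 0) (c := 1) rfl

instance : SetLike.GradedMonoid grading where
  one_mem := by simpa using monomial_mem_grading (a := 0) (b := 0) (c := 0) rfl
  mul_mem m n u v hu hv := by
    have : grading m * grading n ≤ grading (m + n) := by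
      rw [grading, grading, Submodule.span_mul_span, Submodule.span_le]
      rintro _ ⟨_, ⟨a, b, c, rfl, rfl⟩, _, ⟨a', b', c', rfl, rfl⟩, rfl⟩
      have hmul : x ^ a * y ^ b * z ^ c * (x ^ a' * y ^ b' * z ^ c') =
          x ^ (a + a') * y ^ (b + b') * z ^ (c + c') := by ring
      beta_reduce
      rw [SetLike.mem_coe, hmul]
      exact monomial_mem_grading (by ring)
    exact this (Submodule.mul_mem_mul hu hv)

/-- The decomposition of `Ae6` into its homogeneous parts. -/
def decompose : Ae6 →ₐ[ℂ] DirectSum ℕ fun n => grading n :=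
  lift (DirectSum.of (fun n => grading n) 3 ⟨x, x_mem⟩)
    (DirectSum.of (fun n => grading n) 4 ⟨y, y_mem⟩)
    (DirectSum.of (fun n => grading n) 6 ⟨z, z_mem⟩) (by
      rw [DirectSum.ofPow, DirectSum.ofPow, DirectSum.ofPow]
      change DirectSum.of (fun n => grading n) 12 _ + DirectSum.of (fun n => grading n) 12 _ +
        DirectSum.of (fun n => grading n) 12 _ = 0
      rw [← map_add, ← map_add]
      refine (congrArg _ (Subtype.ext ?_)).trans (map_zero _)
      exact relation)

theorem decompose_monomial (a b c n : ℕ) (h : 3 * a + 4 * b + 6 * c = n) :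
    decompose (x ^ a * y ^ b * z ^ c) =
      DirectSum.of (fun n => grading n) n ⟨_, monomial_mem_grading h⟩ := by
  simp only [decompose, map_mul, map_pow, lift_x, lift_y, lift_z, DirectSum.ofPow,
    DirectSum.of_mul_of]
  refine DirectSum.of_eq_of_gradedMonoid_eq (Sigma.subtype_ext ?_ rfl)
  change a • 3 + b • 4 + c • 6 = n
  simp only [smul_eq_mul, ← h]
  ring

instance : GradedAlgebra grading :=
  GradedAlgebra.ofAlgHom grading decompose
    (algHom_ext (by simp [decompose]) (by simp [decompose]) (by simp [decompose]))
    fun n ⟨u, hu⟩ => by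
      induction hu using Submodule.span_induction with
      | mem u hu =>
        obtain ⟨a, b, c, h, rfl⟩ := hu
        exact decompose_monomial a b c n h
      | zero => exact (map_zero _).trans (map_zero (DirectSum.of (fun n => grading n) n)).symm
      | add u v _ _ ihu ihv =>
        rw [map_add, ihu, ihv, ← map_add]
        rfl
      | smul r u _ ih =>
        rw [map_smul, ih]
        exact (DirectSum.lof ℂ ℕ (fun n => grading n) n).map_smul r _ |>.symm

theorem exists_form_of_mem {m : ℕ} {u : Ae6} (hu : u ∈ grading (6 * m)) :
    ∃ q : MvPolynomial (Fin 2) ℂ, q.IsHomogeneous m ∧ aeval ![z, x ^ 2] q = u := by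
  suffices h : grading (6 * m) ≤
      (homogeneousSubmodule (Fin 2) ℂ m).map (aeval ![z, x ^ 2]).toLinearMap from h hu
  refine Submodule.span_le.mpr ?_
  rintro _ ⟨a, b, c, h, rfl⟩
  obtain ⟨a, rfl⟩ : 2 ∣ a := by omega
  obtain ⟨b, rfl⟩ : 3 ∣ b := by omega
  have hm : m = 1 * a + 2 * b + 1 * c := by omega
  refine ⟨X 1 ^ a * (-(X 1 ^ 2 + X 0 ^ 2)) ^ b * X 0 ^ c, ?_, ?_⟩
  · rw [SetLike.mem_coe, mem_homogeneousSubmodule, hm]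
    exact (((isHomogeneous_X ℂ 1).pow a).mul
      ((((isHomogeneous_X_pow 1 2).add (isHomogeneous_X_pow 0 2)).neg).pow b)).mul
      ((isHomogeneous_X ℂ 0).pow c)
  · have : y ^ 3 = -((x ^ 2) ^ 2 + z ^ 2) := by linear_combination relation
    simp [pow_mul, this]

/-- Every homogeneous element of positive degree has one of the factors `x`, `y`, `z - c x²`. -/
theorem exists_factor_of_mem {n : ℕ} (hn : 0 < n) {u : Ae6} (hu : u ∈ grading n) :
    x ∣ u ∨ y ∣ u ∨ ∃ c : ℂ, z - algebraMap ℂ Ae6 c * x ^ 2 ∣ u := by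
  have hdvd (w : Ae6) (h : ∀ a b c, 3 * a + 4 * b + 6 * c = n → w ∣ x ^ a * y ^ b * z ^ c) :
      w ∣ u := by
    suffices grading n ≤ (Ideal.span {w}).restrictScalars ℂ from
      Ideal.mem_span_singleton.mp (this hu)
    refine Submodule.span_le.mpr ?_
    rintro _ ⟨a, b, c, habc, rfl⟩
    exact Ideal.mem_span_singleton.mpr (h a b c habc)
  by_cases h2 : 2 ∣ n
  · by_cases h3 : 3 ∣ n
    · obtain ⟨m, rfl⟩ : ∃ m, n = 6 * (m + 1) := ⟨n / 6 - 1, by omega⟩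
      obtain ⟨q, hq, rfl⟩ := exists_form_of_mem hu
      rcases hq.exists_linear_factor with ⟨r, rfl⟩ | ⟨c, r, rfl⟩
      · left
        simpa using ((dvd_pow_self x two_ne_zero).mul_right _)
      · right; right
        refine ⟨c, aeval ![z, x ^ 2] r, ?_⟩
        simp
    · right; left
      exact hdvd _ fun a b c h => ((dvd_pow_self _ (by omega)).mul_left _).mul_right _
  · left
    exact hdvd _ fun a b c h => ((dvd_pow_self _ (by omega)).mul_right _).mul_right _

end E6

/-! ### Derivations with bounded orbits -/

namespace E6

local notation "x" => e6Gen 0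
local notation "y" => e6Gen 1
local notation "z" => e6Gen 2

open GradedAlgebra

section Bound

variable {D : Derivation ℂ Ae6 Ae6} {k : ℕ}

theorem apply_mul_mem_degreeLE {m n : ℕ} {u v : Ae6} (hu : u ∈ grading m) (hv : v ∈ grading n)
    (hDu : D u ∈ degreeLE grading (m + k)) (hDv : D v ∈ degreeLE grading (n + k)) :
    D (u * v) ∈ degreeLE grading (m + n + k) := by
  rw [Derivation.leibniz, smul_eq_mul, smul_eq_mul]
  refine add_mem ?_ ?_
  · rw [add_assoc]
    exact mul_mem_degreeLE hu hDv
  · rw [add_comm m, add_assoc]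
    exact mul_mem_degreeLE hv hDu

theorem apply_pow_mem_degreeLE {n : ℕ} {u : Ae6} (hu : u ∈ grading n)
    (hDu : D u ∈ degreeLE grading (n + k)) (a : ℕ) :
    D (u ^ a) ∈ degreeLE grading (n * a + k) := by
  induction a with
  | zero => simp
  | succ a ih =>
    rw [pow_succ, mul_add, mul_one]
    refine apply_mul_mem_degreeLE ?_ hu ih hDu
    rw [mul_comm]
    exact SetLike.pow_mem_graded a hu

theorem apply_mem_degreeLE_of_generators (hx : D x ∈ degreeLE grading (3 + k))
    (hy : D y ∈ degreeLE grading (4 + k)) (hz : D z ∈ degreeLE grading (6 + k)) (n : ℕ)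
    (u : Ae6) (hu : u ∈ grading n) : D u ∈ degreeLE grading (n + k) := by
  suffices grading n ≤ (degreeLE grading (n + k)).comap D.toLinearMap from this hu
  refine Submodule.span_le.mpr ?_
  rintro _ ⟨a, b, c, rfl, rfl⟩
  have hpow {m : ℕ} {v : Ae6} (hv : v ∈ grading m) (a : ℕ) : v ^ a ∈ grading (m * a) := by
    rw [mul_comm]
    exact SetLike.pow_mem_graded a hv
  exact apply_mul_mem_degreeLE (SetLike.mul_mem_graded (hpow x_mem a) (hpow y_mem b))
    (hpow z_mem c)
    (apply_mul_mem_degreeLE (hpow x_mem a) (hpow y_mem b) (apply_pow_mem_degreeLE x_mem hx a)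
      (apply_pow_mem_degreeLE y_mem hy b)) (apply_pow_mem_degreeLE z_mem hz c)

end Bound

theorem derivation_eq_zero {δ : Derivation ℂ Ae6 Ae6} (hx : δ x = 0) (hy : δ y = 0)
    (hz : δ z = 0) : δ = 0 := by
  ext u
  obtain ⟨p, rfl⟩ := Ideal.Quotient.mk_surjective u
  induction p using MvPolynomial.induction_on with
  | C c => exact δ.map_algebraMap c
  | add p q hp hq => simpa [hp] using hq
  | mul_X p i hp =>
    rw [map_mul, Derivation.leibniz, hp]
    have : δ (Ideal.Quotient.mk Ie6 (X i)) = 0 := by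
      fin_cases i
      exacts [hx, hy, hz]
    simp [this]

/-- A locally nilpotent derivation that kills a nonzero homogeneous element of positive degree
is zero. -/
theorem derivation_eq_zero_of_apply_homogeneous {δ : Derivation ℂ Ae6 Ae6}
    (hδ : ∀ u, ∃ i, δ^[i] u = 0) {n : ℕ} (hn : 0 < n) {u : Ae6} (hu : u ∈ grading n)
    (hu0 : u ≠ 0) (hδu : δ u = 0) : δ = 0 := by
  rcases exists_factor_of_mem hn hu with ⟨v, rfl⟩ | ⟨v, rfl⟩ | ⟨c, v, rfl⟩
  · have h := Derivation.apply_eq_zero_of_mul hδ hu0 hδu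
    have := derivation_eq_zero_of_apply_x_eq_zero hδ relation x_ne_zero y_ne_zero z_ne_zero h
    exact derivation_eq_zero h this.1 this.2
  · have h := Derivation.apply_eq_zero_of_mul hδ hu0 hδu
    have := derivation_eq_zero_of_apply_y_eq_zero hδ relation x_ne_zero y_ne_zero h
    exact derivation_eq_zero this.1 h this.2
  · have h := Derivation.apply_eq_zero_of_mul hδ hu0 hδu
    have := derivation_eq_zero_of_apply_z_sub_eq_zero hδ relation x_ne_zero y_ne_zero c
      (z_sub_ne_zero c) (x_sq_add_ne_zero c) h
    exact derivation_eq_zero this.1 this.2.1 this.2.2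

theorem component_eq_zero {D : Derivation ℂ Ae6 Ae6} {k : ℕ} (hk : 0 < k)
    (hD : ∀ n, ∀ u ∈ grading n, D u ∈ degreeLE grading (n + k))
    (hfin : ∀ u, ∃ M, ∀ i, D^[i] u ∈ degreeLE grading M) : component grading D k = 0 := by
  have hδ := exists_iterate_component_eq_zero hk hD hfin
  classical
  have hi : Nat.find (hδ x) ≠ 0 := fun h => x_ne_zero (by simpa [h] using Nat.find_spec (hδ x))
  obtain ⟨i, hi⟩ := Nat.exists_eq_succ_of_ne_zero hi
  refine derivation_eq_zero_of_apply_homogeneous hδ (n := 3 + i * k) (by omega)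
    (iterate_component_mem D k x_mem i) (Nat.find_min (hδ x) (by omega)) ?_
  rw [← Function.iterate_succ_apply' (component grading D k), ← hi]
  exact Nat.find_spec (hδ x)

/-- A derivation of `Ae6` with bounded orbits does not raise the degree. -/
theorem apply_mem_degreeLE_of_bounded {D : Derivation ℂ Ae6 Ae6}
    (hfin : ∀ u, ∃ M, ∀ i, D^[i] u ∈ degreeLE grading M) (n : ℕ) (u : Ae6)
    (hu : u ∈ grading n) : D u ∈ degreeLE grading n := by
  obtain ⟨a, ha⟩ := exists_mem_degreeLE (𝒜 := grading) (D x)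
  obtain ⟨b, hb⟩ := exists_mem_degreeLE (𝒜 := grading) (D y)
  obtain ⟨c, hc⟩ := exists_mem_degreeLE (𝒜 := grading) (D z)
  have hstart := apply_mem_degreeLE_of_generators (k := a + b + c) (degreeLE_mono (by omega) ha)
    (degreeLE_mono (by omega) hb) (degreeLE_mono (by omega) hc)
  generalize a + b + c = k at hstart
  induction k with
  | zero => exact hstart n u hu
  | succ k ih =>
    refine ih fun m v hv => mem_degreeLE.mpr fun i hi => ?_
    rcases (Nat.succ_le_of_lt hi).eq_or_lt with rfl | hlt
    · have := component_apply D (k + 1) hv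
      rw [component_eq_zero k.succ_pos hstart hfin] at this
      exact this.symm
    · exact mem_degreeLE.mp (hstart m v hv) i hlt

end E6

/-! ### Automorphisms of the coordinate ring -/

namespace E6

local notation "x" => e6Gen 0
local notation "y" => e6Gen 1
local notation "z" => e6Gen 2

open GradedAlgebra

theorem exists_eq_of_mem_zero {u : Ae6} (hu : u ∈ grading 0) : ∃ a : ℂ, u = a • 1 := by
  suffices grading 0 ≤ Submodule.span ℂ {1} from
    (Submodule.mem_span_singleton.mp (this hu)).imp fun _ h => h.symm
  refine Submodule.span_le.mpr ?_
  rintro _ ⟨a, b, c, h, rfl⟩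
  obtain ⟨rfl, rfl, rfl⟩ : a = 0 ∧ b = 0 ∧ c = 0 := by omega
  simp

theorem exists_eq_of_mem_three {u : Ae6} (hu : u ∈ grading 3) : ∃ a : ℂ, u = a • x := by
  suffices grading 3 ≤ Submodule.span ℂ {x} from
    (Submodule.mem_span_singleton.mp (this hu)).imp fun _ h => h.symm
  refine Submodule.span_le.mpr ?_
  rintro _ ⟨a, b, c, h, rfl⟩
  obtain ⟨rfl, rfl, rfl⟩ : a = 1 ∧ b = 0 ∧ c = 0 := by omega
  simp

theorem exists_eq_of_mem_four {u : Ae6} (hu : u ∈ grading 4) : ∃ a : ℂ, u = a • y := by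
  suffices grading 4 ≤ Submodule.span ℂ {y} from
    (Submodule.mem_span_singleton.mp (this hu)).imp fun _ h => h.symm
  refine Submodule.span_le.mpr ?_
  rintro _ ⟨a, b, c, h, rfl⟩
  obtain ⟨rfl, rfl, rfl⟩ : a = 0 ∧ b = 1 ∧ c = 0 := by omega
  simp

theorem exists_eq_of_mem_six {u : Ae6} (hu : u ∈ grading 6) :
    ∃ a b : ℂ, u = a • z + b • x ^ 2 := by
  suffices grading 6 ≤ Submodule.span ℂ {z, x ^ 2} by
    obtain ⟨a, b, h⟩ := Submodule.mem_span_pair.mp (this hu)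
    exact ⟨a, b, h.symm⟩
  refine Submodule.span_le.mpr ?_
  rintro _ ⟨a, b, c, h, rfl⟩
  obtain ⟨rfl, rfl, rfl⟩ | ⟨rfl, rfl, rfl⟩ :
      (a = 0 ∧ b = 0 ∧ c = 1) ∨ (a = 2 ∧ b = 0 ∧ c = 0) := by omega
  · simpa using Submodule.subset_span (s := {z, x ^ 2}) (Set.mem_insert _ _)
  · simpa using Submodule.subset_span (s := {z, x ^ 2}) (Set.mem_insert_of_mem _ rfl)

theorem grading_eq_bot {n : ℕ} (hn : n = 1 ∨ n = 2 ∨ n = 5) : grading n = ⊥ := by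
  refine Submodule.span_eq_bot.mpr ?_
  rintro _ ⟨a, b, c, h, rfl⟩
  omega

theorem proj_eq_zero {n : ℕ} (hn : n = 1 ∨ n = 2 ∨ n = 5) (u : Ae6) : proj grading n u = 0 :=
  (Submodule.mem_bot ℂ).mp (grading_eq_bot hn ▸ proj_mem n u)

theorem exists_eq_of_mem_degreeLE_three {u : Ae6} (hu : u ∈ degreeLE grading 3) :
    ∃ a b : ℂ, u = a • 1 + b • x := by
  obtain ⟨a, ha⟩ := exists_eq_of_mem_zero (proj_mem 0 u)
  obtain ⟨b, hb⟩ := exists_eq_of_mem_three (proj_mem 3 u)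
  refine ⟨a, b, (eq_sum_proj hu).trans ?_⟩
  simp [Finset.sum_range_succ, -proj_apply, proj_eq_zero, ha, hb]

theorem exists_eq_of_mem_degreeLE_four {u : Ae6} (hu : u ∈ degreeLE grading 4) :
    ∃ a b c : ℂ, u = a • 1 + b • x + c • y := by
  obtain ⟨a, ha⟩ := exists_eq_of_mem_zero (proj_mem 0 u)
  obtain ⟨b, hb⟩ := exists_eq_of_mem_three (proj_mem 3 u)
  obtain ⟨c, hc⟩ := exists_eq_of_mem_four (proj_mem 4 u)
  refine ⟨a, b, c, (eq_sum_proj hu).trans ?_⟩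
  simp [Finset.sum_range_succ, -proj_apply, proj_eq_zero, ha, hb, hc]

theorem exists_eq_of_mem_degreeLE_six {u : Ae6} (hu : u ∈ degreeLE grading 6) :
    ∃ a b c d e : ℂ, u = a • 1 + b • x + c • y + (d • z + e • x ^ 2) := by
  obtain ⟨a, ha⟩ := exists_eq_of_mem_zero (proj_mem 0 u)
  obtain ⟨b, hb⟩ := exists_eq_of_mem_three (proj_mem 3 u)
  obtain ⟨c, hc⟩ := exists_eq_of_mem_four (proj_mem 4 u)
  obtain ⟨d, e, hde⟩ := exists_eq_of_mem_six (proj_mem 6 u)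
  refine ⟨a, b, c, d, e, (eq_sum_proj hu).trans ?_⟩
  simp [Finset.sum_range_succ, -proj_apply, proj_eq_zero, ha, hb, hc, hde]

/-- A derivation of `Ae6` that does not raise the degree is a multiple of the Euler derivation. -/
theorem exists_eq_smul_euler {D : Derivation ℂ Ae6 Ae6}
    (hD : ∀ n, ∀ u ∈ grading n, D u ∈ degreeLE grading n) : ∃ c : ℂ, D = c • euler grading := by
  obtain ⟨a₀, a₁, hDx⟩ := exists_eq_of_mem_degreeLE_three (hD 3 x x_mem)
  obtain ⟨b₀, b₁, b₂, hDy⟩ := exists_eq_of_mem_degreeLE_four (hD 4 y y_mem)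
  obtain ⟨c₀, c₁, c₂, c₃, c₄, hDz⟩ := exists_eq_of_mem_degreeLE_six (hD 6 z z_mem)
  have h := derivation_relation (D := D) relation
  obtain ⟨h₁, h₂, h₃, h₄, h₅, h₆, h₇, h₈, h₉⟩ :=
    monomials_independent (a₃ := 4 * a₀) (a₄ := 4 * a₁ - 3 * b₂) (b₀ := 3 * b₀) (b₁ := 3 * b₁)
      (c₀ := 2 * c₀) (c₁ := 2 * c₁) (c₂ := 2 * c₄) (d := 2 * c₂) (e := 2 * c₃ - 3 * b₂) (by
      rw [hDx, hDy, hDz] at h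
      simp only [smul_eq, map_mul, map_sub, map_ofNat] at h ⊢
      linear_combination h - 3 * algebraMap ℂ Ae6 b₂ * relation)
  obtain rfl : a₀ = 0 := by linear_combination h₁ / 4
  obtain rfl : b₀ = 0 := by linear_combination h₃ / 3
  obtain rfl : b₁ = 0 := by linear_combination h₄ / 3
  obtain rfl : c₀ = 0 := by linear_combination h₅ / 2
  obtain rfl : c₁ = 0 := by linear_combination h₆ / 2
  obtain rfl : c₂ = 0 := by linear_combination h₈ / 2
  obtain rfl : c₄ = 0 := by linear_combination h₇ / 2
  refine ⟨b₂ / 4, sub_eq_zero.mp (derivation_eq_zero ?_ ?_ ?_)⟩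
  · rw [Derivation.sub_apply, Derivation.smul_apply, euler_apply x_mem, hDx, smul_smul]
    simp only [zero_smul, zero_add, ← sub_smul]
    convert zero_smul ℂ x
    push_cast
    linear_combination h₂ / 4
  · rw [Derivation.sub_apply, Derivation.smul_apply, euler_apply y_mem, hDy, smul_smul]
    simp only [zero_smul, zero_add, ← sub_smul]
    convert zero_smul ℂ y
    push_cast
    ring
  · rw [Derivation.sub_apply, Derivation.smul_apply, euler_apply z_mem, hDz, smul_smul]
    simp only [zero_smul, zero_add, add_zero, ← sub_smul]
    convert zero_smul ℂ z
    push_cast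
    linear_combination h₉ / 2

theorem eq_one_of_mul_eq_natCast {c : ℂ} {k l m n : ℕ} (hk : 3 * c = k) (hl : 4 * c = l)
    (hm : 3 = c * m) (hn : 4 = c * n) : c = 1 := by
  have hc : c = (l - k : ℤ) := by
    push_cast
    linear_combination hl - hk
  have hinv : c * (n - m : ℤ) = 1 := by
    push_cast
    linear_combination hm - hn
  rw [hc] at hinv hk ⊢
  norm_cast at hinv hk ⊢
  rcases Int.eq_one_or_neg_one_of_mul_eq_one hinv with h | h
  · exact h
  · omega

/-- Every automorphism of `Ae6` preserves the grading. -/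
theorem conj_euler (φ : Ae6 ≃ₐ[ℂ] Ae6) : (euler grading).conj φ = euler grading := by
  have hfin (u : Ae6) : ∃ M, ∀ i, ((euler grading).conj φ)^[i] u ∈ degreeLE grading M := by
    obtain ⟨v, rfl⟩ := φ.surjective u
    simpa only [Derivation.iterate_conj_apply] using
      exists_forall_iterate_conj_mem_degreeLE φ v
  obtain ⟨c, hc⟩ := exists_eq_smul_euler (apply_mem_degreeLE_of_bounded hfin)
  have hsymm {n : ℕ} {u : Ae6} (hu : u ∈ grading n) (hu0 : u ≠ 0) : ∃ k : ℕ, n * c = k := by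
    have h : euler grading (φ.symm u) = (n * c : ℂ) • φ.symm u := by
      apply φ.injective
      rw [← Derivation.conj_apply, hc, map_smul, φ.apply_symm_apply, Derivation.smul_apply,
        euler_apply hu, smul_smul, mul_comm]
    obtain ⟨k, hk, -⟩ := exists_mem_of_euler_eq_smul (by simpa using hu0) h
    exact ⟨k, hk⟩
  have hne : c ≠ 0 := by
    rintro rfl
    have h := (euler grading).conj_apply φ x
    rw [hc, zero_smul, euler_apply x_mem, map_smul] at h
    exact smul_ne_zero (Nat.cast_ne_zero.mpr three_ne_zero)
      ((map_ne_zero_iff φ φ.injective).mpr x_ne_zero) h.symm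
  have happly {n : ℕ} {u : Ae6} (hu : u ∈ grading n) (hu0 : u ≠ 0) : ∃ k : ℕ, n = c * k := by
    have h := (euler grading).conj_apply φ u
    rw [hc, euler_apply hu, Derivation.smul_apply, map_smul] at h
    obtain ⟨k, hk, -⟩ := exists_mem_of_euler_eq_smul (𝒜 := grading) (c := c⁻¹ * n)
      ((map_ne_zero_iff φ φ.injective).mpr hu0) (by rw [mul_smul, ← h, inv_smul_smul₀ hne])
    exact ⟨k, by rw [← hk, mul_inv_cancel_left₀ hne]⟩
  obtain ⟨k, hk⟩ := hsymm x_mem x_ne_zero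
  obtain ⟨l, hl⟩ := hsymm y_mem y_ne_zero
  obtain ⟨m, hm⟩ := happly x_mem x_ne_zero
  obtain ⟨n, hn⟩ := happly y_mem y_ne_zero
  have hc1 : c = 1 :=
    eq_one_of_mul_eq_natCast (mod_cast hk) (mod_cast hl) (mod_cast hm) (mod_cast hn)
  rw [hc, hc1, one_smul]

theorem map_mem_grading (φ : Ae6 ≃ₐ[ℂ] Ae6) {n : ℕ} {u : Ae6} (hu : u ∈ grading n) :
    φ u ∈ grading n := by
  rcases eq_or_ne u 0 with rfl | hu0
  · simp
  have h := (euler grading).conj_apply φ u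
  rw [conj_euler, euler_apply hu, map_smul] at h
  obtain ⟨k, hk, hmem⟩ := exists_mem_of_euler_eq_smul (by simpa using hu0) h
  rwa [Nat.cast_injective hk]

end E6

/-- Every ℂ-algebra automorphism of A is diagonal. -/
theorem e6_autos_diagonal (φ : Ae6 ≃ₐ[ℂ] Ae6) :
    ∃ α β γ : ℂ, α ≠ 0 ∧ β ≠ 0 ∧ γ ≠ 0 ∧ (α ^ 4 = β ^ 3 ∧ β ^ 3 = γ ^ 2) ∧
      φ (Ideal.Quotient.mk Ie6 (X 0)) = α • Ideal.Quotient.mk Ie6 (X 0) ∧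
      φ (Ideal.Quotient.mk Ie6 (X 1)) = β • Ideal.Quotient.mk Ie6 (X 1) ∧
      φ (Ideal.Quotient.mk Ie6 (X 2)) = γ • Ideal.Quotient.mk Ie6 (X 2) := by
  obtain ⟨α, hα⟩ := E6.exists_eq_of_mem_three (E6.map_mem_grading φ E6.x_mem)
  obtain ⟨β, hβ⟩ := E6.exists_eq_of_mem_four (E6.map_mem_grading φ E6.y_mem)
  obtain ⟨γ, δ, hγ⟩ := E6.exists_eq_of_mem_six (E6.map_mem_grading φ E6.z_mem)
  have hα0 : α ≠ 0 := by
    rintro rfl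
    simp [E6.x_ne_zero] at hα
  have hβ0 : β ≠ 0 := by
    rintro rfl
    simp [E6.y_ne_zero] at hβ
  have hrel := congrArg φ E6.relation
  rw [map_add, map_add, map_pow, map_pow, map_pow, hα, hβ, hγ, map_zero] at hrel
  obtain ⟨-, h₁, -, -, -, -, h₂, -, h₃⟩ :=
    E6.monomials_independent (a₃ := 0) (a₄ := α ^ 4 + δ ^ 2 - β ^ 3) (b₀ := 0) (b₁ := 0)
      (c₀ := 0) (c₁ := 0) (c₂ := 2 * γ * δ) (d := 0) (e := γ ^ 2 - β ^ 3) (by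
      simp only [E6.smul_eq, map_mul, map_add, map_sub, map_pow, map_ofNat, map_zero] at hrel ⊢
      linear_combination hrel - algebraMap ℂ Ae6 β ^ 3 * E6.relation)
  have hγ0 : γ ≠ 0 := by
    rintro rfl
    exact pow_ne_zero 3 hβ0 (by linear_combination -h₃)
  obtain rfl : δ = 0 := by simpa [hγ0] using h₂
  refine ⟨α, β, γ, hα0, hβ0, hγ0, ⟨by linear_combination h₁, by linear_combination -h₃⟩, hα, hβ, ?_⟩
  rw [zero_smul, add_zero] at hγ
  exact hγ

end
end
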